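/- arXiv:1201.2267 — 3 statements merged into one kernel-verified Lean document; each statement's English description precedes it below -/
import Mathlib

section
/- For every planar n-point set P in general position and every k ∈ {1,…,n}, there exists a k-partition of P whose crossing number is O(log(n/k)); that is, there is a universal constant C > 0 such that for all n, all k ∈ {1,…,n} with n/k ≥ 2, and every set P of n points in ℝ² in general position, some k-partition of P has crossing number at most C·log₂(n/k). -/
open scoped Classical

noncomputable section

/-- A planar point set is in general position if no three distinct points are collinear. -/
def GenPos2 (P : Finset (ℝ × ℝ)) : Prop :=
  ∀ p ∈ P, ∀ q ∈ P, ∀ r ∈ P, p ≠ q → q ≠ r → p ≠ r →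
    ¬ Collinear ℝ ({p, q, r} : Set (ℝ × ℝ))

/-- The triangle (convex hull) spanned by three points. -/
def triangle (t : Fin 3 → ℝ × ℝ) : Set (ℝ × ℝ) :=
  convexHull ℝ {t 0, t 1, t 2}

/-- The non-vertical line `y = a*x + b`, as a set of points. -/
def lineSet (a b : ℝ) : Set (ℝ × ℝ) := {p | p.2 = a * p.1 + b}

/-- The open halfplane strictly below the line `y = a*x + b`. -/
def belowSet (a b : ℝ) : Set (ℝ × ℝ) := {p | p.2 < a * p.1 + b}

/-- A `k`-partition of an `n`-point set `P` : pairwise disjoint parts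
`P_1, …, P_⌈n/k⌉` covering `P`, where the first `⌊n/k⌋` parts have size
exactly `k`, together with triangles containing the parts.
(Here `⌈n/k⌉ = (n + k - 1) / k` in natural-number arithmetic, and the
parts are indexed by `i = 0, …, ⌈n/k⌉ - 1`, the first `⌊n/k⌋ = n / k`
of them having size `k`.) -/
structure IsKPartition (P : Finset (ℝ × ℝ)) (n k : ℕ)
    (parts : Fin ((n + k - 1) / k) → Finset (ℝ × ℝ))
    (tri : Fin ((n + k - 1) / k) → Fin 3 → ℝ × ℝ) : Prop where
  disjoint : ∀ i j, i ≠ j → Disjoint (parts i) (parts j)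
  cover : Finset.univ.biUnion parts = P
  size : ∀ i : Fin ((n + k - 1) / k), (i : ℕ) < n / k → (parts i).card = k
  inTriangle : ∀ i, ↑(parts i) ⊆ triangle (tri i)

/-- The line `y = a*x + b` is `k`-shallow for `P` : it contains no point of `P`
and at most `k` points of `P` lie strictly below it. -/
def IsShallow (P : Finset (ℝ × ℝ)) (k : ℕ) (a b : ℝ) : Prop :=
  (∀ p ∈ P, p ∉ lineSet a b) ∧ (P.filter (fun p => p ∈ belowSet a b)).card ≤ k

/-- The number of triangles of the partition that the line `y = a*x + b` intersects. -/
def crossCount {N : ℕ} (tri : Fin N → Fin 3 → ℝ × ℝ) (a b : ℝ) : ℕ :=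
  (Finset.univ.filter fun i => (lineSet a b ∩ triangle (tri i)).Nonempty).card

/-- The value at `x` of the linear function whose graph is the line `l = (slope, intercept)`. -/
def lineAt (l : ℝ × ℝ) (x : ℝ) : ℝ := l.1 * x + l.2

/-- The points of `P` strictly below the line `l`. -/
def below (P : Finset (ℝ × ℝ)) (l : ℝ × ℝ) : Finset (ℝ × ℝ) :=
  P.filter fun p => p.2 < lineAt l p.1

/-- The line `l` contains no point of `P`. -/
def Avoids (P : Finset (ℝ × ℝ)) (l : ℝ × ℝ) : Prop := ∀ p ∈ P, p.2 ≠ lineAt l p.1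

/-- The line `l` meets the triangle `t`. -/
def Crosses (l : ℝ × ℝ) (t : Fin 3 → ℝ × ℝ) : Prop :=
  (lineSet l.1 l.2 ∩ triangle t).Nonempty

lemma mem_below {P : Finset (ℝ × ℝ)} {l p : ℝ × ℝ} :
    p ∈ below P l ↔ p ∈ P ∧ p.2 < lineAt l p.1 := by
  simp [below]

lemma below_subset (P : Finset (ℝ × ℝ)) (l : ℝ × ℝ) : below P l ⊆ P :=
  Finset.filter_subset _ _

lemma crosses_iff {l : ℝ × ℝ} {t : Fin 3 → ℝ × ℝ} :
    Crosses l t ↔ ∃ z ∈ triangle t, z.2 = lineAt l z.1 := by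
  constructor
  · rintro ⟨z, hz, hzt⟩
    exact ⟨z, hzt, hz⟩
  · rintro ⟨z, hzt, hz⟩
    exact ⟨z, hz, hzt⟩

lemma convex_above (l : ℝ × ℝ) : Convex ℝ {z : ℝ × ℝ | lineAt l z.1 < z.2} := by
  intro x hx y hy α β hα hβ hαβ
  simp only [Set.mem_ofPred_eq, lineAt, Prod.fst_add, Prod.snd_add, Prod.smul_fst, Prod.smul_snd,
    smul_eq_mul] at *
  obtain rfl : β = 1 - α := by linarith
  rcases hα.eq_or_lt with rfl | hα
  · simpa using hy
  · nlinarith [mul_lt_mul_of_pos_left hx hα, mul_le_mul_of_nonneg_left hy.le hβ]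

lemma triangle_subset {C : Set (ℝ × ℝ)} (hC : Convex ℝ C) {t : Fin 3 → ℝ × ℝ}
    (ht : ∀ i, t i ∈ C) : triangle t ⊆ C := by
  apply convexHull_min _ hC
  rintro z (rfl | rfl | rfl) <;> apply ht

lemma combination_mem_triangle {t : Fin 3 → ℝ × ℝ} {α β γ : ℝ} (hα : 0 ≤ α) (hβ : 0 ≤ β)
    (hγ : 0 ≤ γ) (h : α + β + γ = 1) : α • t 0 + β • t 1 + γ • t 2 ∈ triangle t := by
  have hconv : Convex ℝ (triangle t) := convex_convexHull ℝ _
  have h0 : t 0 ∈ triangle t := subset_convexHull ℝ _ (by simp)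
  have h1 : t 1 ∈ triangle t := subset_convexHull ℝ _ (by simp)
  have h2 : t 2 ∈ triangle t := subset_convexHull ℝ _ (by simp)
  have := hconv.sum_mem (t := Finset.univ) (w := ![α, β, γ]) (z := t)
    (by intro i _; fin_cases i <;> simpa) (by simp [Fin.sum_univ_three, h])
    (by intro i _; fin_cases i <;> assumption)
  simpa [Fin.sum_univ_three] using this

/-- A triangle that a line does not meet lies strictly below the line as soon as one of its points
is not above the line. -/
lemma below_of_not_crosses {l : ℝ × ℝ} {t : Fin 3 → ℝ × ℝ} (h : ¬ Crosses l t) {z : ℝ × ℝ}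
    (hz : z ∈ triangle t) (hzl : z.2 ≤ lineAt l z.1) {p : ℝ × ℝ} (hp : p ∈ triangle t) :
    p.2 < lineAt l p.1 := by
  by_contra! hcon
  have hpre : IsPreconnected (triangle t) := (convex_convexHull ℝ _).isPreconnected
  obtain ⟨w, hw, hw0⟩ := hpre.intermediate_value₂ (f := fun p => p.2)
    (g := fun p => lineAt l p.1) hz hp (by fun_prop) (by unfold lineAt; fun_prop) hzl hcon
  exact h (crosses_iff.2 ⟨w, hw, hw0⟩)

lemma not_crosses_of_forall_above {g h : ℝ × ℝ} {x₁ x₂ : ℝ} {t : Fin 3 → ℝ × ℝ}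
    (ht : ∀ i, ((t i).1 = x₁ ∨ (t i).1 = x₂) ∧ lineAt h (t i).1 < (t i).2)
    (h₁ : lineAt g x₁ ≤ lineAt h x₁) (h₂ : lineAt g x₂ ≤ lineAt h x₂) : ¬ Crosses g t := by
  rw [crosses_iff]
  rintro ⟨z, hz, hzg⟩
  have : triangle t ⊆ {z : ℝ × ℝ | lineAt g z.1 < z.2} := by
    apply triangle_subset (convex_above g)
    intro i
    obtain ⟨hx, hi⟩ := ht i
    simp only [Set.mem_ofPred_eq]
    rcases hx with hx | hx <;> rw [hx] at hi ⊢ <;> linarith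
  have := this hz
  simp only [Set.mem_ofPred_eq] at this
  linarith

/-- Half of a finite set above a line can be enclosed in a triangle above that line. -/
lemma exists_triangle_above (h : ℝ × ℝ) (S : Finset (ℝ × ℝ)) (k : ℕ) (hk : 1 ≤ k)
    (hS : 2 * k ≤ S.card) (habove : ∀ p ∈ S, lineAt h p.1 < p.2) :
    ∃ S' ⊆ S, S'.card = k ∧ ∃ p₁ ∈ S, ∃ p₂ ∈ S, p₁.1 ≤ p₂.1 ∧ ∃ t : Fin 3 → ℝ × ℝ,
      ↑S' ⊆ triangle t ∧
      ∀ i, ((t i).1 = p₁.1 ∨ (t i).1 = p₂.1) ∧ lineAt h (t i).1 < (t i).2 := by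
  have hne : S.Nonempty := Finset.card_pos.1 (by omega)
  obtain ⟨p₁, hp₁, hmin⟩ := S.exists_min_image (fun p => p.1) hne
  obtain ⟨p₂, hp₂, hmax⟩ := S.exists_max_image (fun p => p.1) hne
  obtain ⟨p₃, hp₃, hlo⟩ := S.exists_min_image (fun p => p.2 - lineAt h p.1) hne
  obtain ⟨p₄, hp₄, hhi⟩ := S.exists_max_image (fun p => p.2 - lineAt h p.1) hne
  set lo := p₃.2 - lineAt h p₃.1 with hlo_def
  set hi := p₄.2 - lineAt h p₄.1 with hhi_def
  have hlo0 : 0 < lo := by have := habove p₃ hp₃; simp only [hlo_def]; linarith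
  have hlohi : lo ≤ hi := hhi p₃ hp₃
  let t₁ : Fin 3 → ℝ × ℝ := ![(p₁.1, lineAt h p₁.1 + lo), (p₂.1, lineAt h p₂.1 + lo),
    (p₁.1, lineAt h p₁.1 + hi)]
  let t₂ : Fin 3 → ℝ × ℝ := ![(p₂.1, lineAt h p₂.1 + lo), (p₁.1, lineAt h p₁.1 + hi),
    (p₂.1, lineAt h p₂.1 + hi)]
  have hcover : ∀ p ∈ S, p ∈ triangle t₁ ∨ p ∈ triangle t₂ := by
    intro p hp
    have hx : p.1 ∈ segment ℝ p₁.1 p₂.1 := by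
      rw [segment_eq_Icc (hmin p₂ hp₂)]; exact ⟨hmin p hp, hmax p hp⟩
    have hy : p.2 - lineAt h p.1 ∈ segment ℝ lo hi := by
      rw [segment_eq_Icc hlohi]; exact ⟨hlo p hp, hhi p hp⟩
    obtain ⟨a, u, ha, hu, hau, hx⟩ := hx
    obtain ⟨c, v, hc, hv, hcv, hy⟩ := hy
    obtain rfl : a = 1 - u := by linarith
    obtain rfl : c = 1 - v := by linarith
    simp only [smul_eq_mul] at hx hy
    have hy' : p.2 = lineAt h p.1 + ((1 - v) * lo + v * hi) := by linarith
    rcases le_total (u + v) 1 with huv | huv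
    · left
      convert combination_mem_triangle (t := t₁) (α := 1 - u - v) (β := u) (γ := v)
        (by linarith) hu hv (by ring) using 1
      ext
      · simp [t₁, ← hx]; ring
      · simp [t₁, hy', ← hx, lineAt]; ring
    · right
      convert combination_mem_triangle (t := t₂) (α := 1 - v) (β := 1 - u) (γ := u + v - 1)
        (by linarith) ha (by linarith) (by ring) using 1
      ext
      · simp [t₂, ← hx]; ring
      · simp [t₂, hy', ← hx, lineAt]; ring
  have hcard : k ≤ (S.filter (· ∈ triangle t₁)).card ∨ k ≤ (S.filter (· ∈ triangle t₂)).card := by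
    have hsub : S ⊆ S.filter (· ∈ triangle t₁) ∪ S.filter (· ∈ triangle t₂) := by
      intro p hp
      simp only [Finset.mem_union, Finset.mem_filter]
      have := hcover p hp
      tauto
    have h₁ := Finset.card_le_card hsub
    have h₂ := Finset.card_union_le (S.filter (· ∈ triangle t₁)) (S.filter (· ∈ triangle t₂))
    omega
  have conclude : ∀ t : Fin 3 → ℝ × ℝ, k ≤ (S.filter (· ∈ triangle t)).card →
      (∀ i, ((t i).1 = p₁.1 ∨ (t i).1 = p₂.1) ∧ lineAt h (t i).1 < (t i).2) →
      ∃ S' ⊆ S, S'.card = k ∧ ∃ p₁ ∈ S, ∃ p₂ ∈ S, p₁.1 ≤ p₂.1 ∧ ∃ t : Fin 3 → ℝ × ℝ,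
        ↑S' ⊆ triangle t ∧
        ∀ i, ((t i).1 = p₁.1 ∨ (t i).1 = p₂.1) ∧ lineAt h (t i).1 < (t i).2 := by
    intro t ht hti
    obtain ⟨S', hS', hS'k⟩ := Finset.exists_subset_card_eq ht
    refine ⟨S', hS'.trans (Finset.filter_subset _ _), hS'k, p₁, hp₁, p₂, hp₂, hmin p₂ hp₂, t, ?_,
      hti⟩
    intro p hp
    exact (Finset.mem_filter.1 (hS' hp)).2
  rcases hcard with hc | hc
  · refine conclude t₁ hc fun i => ?_
    fin_cases i <;> simp [t₁] <;> linarith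
  · refine conclude t₂ hc fun i => ?_
    fin_cases i <;> simp [t₂] <;> linarith

/-- The elements of weighted rank less than `L` have total weight at least `L`. -/
lemma le_sum_top {α : Type*} (Q : Finset α) (w v : α → ℝ) (hw : ∀ q ∈ Q, 0 < w q) {L : ℝ}
    (hL : L ≤ ∑ q ∈ Q, w q) :
    L ≤ ∑ h ∈ Q with ∑ g ∈ Q with v h < v g, w g < L, w h := by
  by_contra! hcon
  set T := Q.filter fun h => ∑ g ∈ Q with v h < v g, w g < L with hT
  have hne : (Q \ T).Nonempty := by
    by_contra hemp
    rw [Finset.not_nonempty_iff_eq_empty, Finset.sdiff_eq_empty_iff_subset] at hemp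
    have := Finset.sum_le_sum_of_subset_of_nonneg hemp
      (fun i hi _ => (hw i (Finset.mem_of_mem_filter i hi)).le)
    linarith
  obtain ⟨h, hh, hmax⟩ := (Q \ T).exists_max_image v hne
  rw [Finset.mem_sdiff] at hh
  refine hh.2 (Finset.mem_filter.2 ⟨hh.1, lt_of_le_of_lt ?_ hcon⟩)
  apply Finset.sum_le_sum_of_subset_of_nonneg
  · intro g hg
    rw [Finset.mem_filter] at hg
    by_contra hgT
    exact absurd (hmax g (Finset.mem_sdiff.2 ⟨hg.1, hgT⟩)) (not_le.2 hg.2)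
  · intro i hi _
    exact (hw i (Finset.mem_of_mem_filter i hi)).le

/-- Given weighted lines with at most `s` points below each, some triangle captures `k` points
while being crossed only by lines of small total weight. -/
lemma exists_lightly_crossed_triangle (Q : Finset (ℝ × ℝ)) (w : ℝ × ℝ → ℝ)
    (hw : ∀ q ∈ Q, 0 < w q) (hQ : Q.Nonempty) (X : Finset (ℝ × ℝ)) (s k : ℕ) (hk : 1 ≤ k)
    (havoid : ∀ q ∈ Q, Avoids X q) (hs : ∀ q ∈ Q, (below X q).card ≤ s)
    (hX : s + 2 * k ≤ X.card) :
    ∃ S ⊆ X, S.card = k ∧ ∃ t : Fin 3 → ℝ × ℝ, ↑S ⊆ triangle t ∧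
      (∀ z ∈ triangle t, ∃ m ∈ X, ∃ m' ∈ X, m.1 ≤ z.1 ∧ z.1 ≤ m'.1) ∧
      (X.card : ℝ) * ∑ q ∈ Q with Crosses q t, w q ≤ 2 * (s + 2 * k) * ∑ q ∈ Q, w q := by
  set W := ∑ q ∈ Q, w q with hW
  have hW0 : 0 < W := Finset.sum_pos hw hQ
  have hx0 : (0 : ℝ) < X.card := by
    have : 0 < X.card := by omega
    exact_mod_cast this
  have hXr : (s + 2 * k : ℝ) ≤ X.card := by exact_mod_cast hX
  set L := W * (s + 2 * k) / X.card with hL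
  have hLW : L ≤ W := by
    rw [hL, div_le_iff₀ hx0]
    exact mul_le_mul_of_nonneg_left hXr hW0.le
  let good (h p : ℝ × ℝ) : Prop :=
    ∑ g ∈ Q with lineAt h p.1 < lineAt g p.1, w g < L ∧ lineAt h p.1 < p.2
  have hpt : ∀ p ∈ X, L ≤ (∑ h ∈ Q with good h p, w h) + ∑ h ∈ Q with p ∈ below X h, w h := by
    intro p hp
    refine (le_sum_top Q w (fun g => lineAt g p.1) hw hLW).trans ?_
    rw [← Finset.sum_union_inter]
    refine le_trans ?_ (le_add_of_nonneg_right ?_)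
    · apply Finset.sum_le_sum_of_subset_of_nonneg
      · intro h hh
        simp only [Finset.mem_filter, Finset.mem_union, mem_below, good] at hh ⊢
        rcases lt_or_gt_of_ne (havoid h hh.1 p hp) with h1 | h1 <;> tauto
      · intro i hi _
        simp only [Finset.mem_union, Finset.mem_filter] at hi
        exact (hw i (by tauto)).le
    · apply Finset.sum_nonneg
      intro i hi
      simp only [Finset.mem_inter, Finset.mem_filter] at hi
      exact (hw i (by tauto)).le
  have hbelow : ∑ p ∈ X, ∑ h ∈ Q with p ∈ below X h, w h ≤ W * s := by
    simp only [Finset.sum_filter]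
    rw [Finset.sum_comm, hW, Finset.sum_mul]
    apply Finset.sum_le_sum
    intro q hq
    rw [← Finset.sum_filter, Finset.sum_const, nsmul_eq_mul, mul_comm,
      Finset.filter_mem_eq_inter, Finset.inter_eq_right.2 (below_subset X q)]
    exact mul_le_mul_of_nonneg_left (by exact_mod_cast hs q hq) (hw q hq).le
  have hgood : W * (2 * k) ≤ ∑ h ∈ Q, w h * (X.filter (good h)).card := by
    have h1 := Finset.sum_le_sum hpt
    rw [Finset.sum_const, nsmul_eq_mul, Finset.sum_add_distrib] at h1
    have h2 : (X.card : ℝ) * L = W * (s + 2 * k) := by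
      rw [hL]; field_simp
    have h3 : ∑ p ∈ X, ∑ h ∈ Q with good h p, w h = ∑ h ∈ Q, w h * (X.filter (good h)).card := by
      simp only [Finset.sum_filter]
      rw [Finset.sum_comm]
      apply Finset.sum_congr rfl
      intro q _
      rw [← Finset.sum_filter, Finset.sum_const, nsmul_eq_mul, mul_comm]
    rw [h3] at h1
    linarith
  obtain ⟨h, hh, hcard⟩ : ∃ h ∈ Q, 2 * k ≤ (X.filter (good h)).card := by
    by_contra! hcon
    refine absurd hgood (not_le.2 ?_)
    rw [hW, Finset.sum_mul]
    apply Finset.sum_lt_sum_of_nonempty hQ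
    intro q hq
    exact mul_lt_mul_of_pos_left (by exact_mod_cast hcon q hq) (hw q hq)
  obtain ⟨S, hSX, hSk, p₁, hp₁, p₂, hp₂, hp₁₂, t, hSt, ht⟩ :=
    exists_triangle_above h _ k hk hcard (fun p hp => (Finset.mem_filter.1 hp).2.2)
  rw [Finset.mem_filter] at hp₁ hp₂
  refine ⟨S, hSX.trans (Finset.filter_subset _ _), hSk, t, hSt, ?_, ?_⟩
  · intro z hz
    have hsub : triangle t ⊆ Set.Icc p₁.1 p₂.1 ×ˢ Set.univ := by
      apply triangle_subset ((convex_Icc _ _).prod convex_univ)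
      intro i
      rcases (ht i).1 with hi | hi <;> simp [hi, hp₁₂]
    exact ⟨p₁, hp₁.1, p₂, hp₂.1, (hsub hz).1⟩
  · have hle : ∑ q ∈ Q with Crosses q t, w q ≤ L + L := by
      refine le_trans ?_ (add_le_add hp₁.2.1.le hp₂.2.1.le)
      rw [← Finset.sum_union_inter]
      refine le_trans ?_ (le_add_of_nonneg_right ?_)
      · apply Finset.sum_le_sum_of_subset_of_nonneg
        · intro g hg
          simp only [Finset.mem_filter, Finset.mem_union] at hg ⊢
          by_contra! hcon
          exact not_crosses_of_forall_above ht (hcon.1 hg.1) (hcon.2 hg.1) hg.2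
        · intro i hi _
          simp only [Finset.mem_union, Finset.mem_filter] at hi
          exact (hw i (by tauto)).le
      · apply Finset.sum_nonneg
        intro i hi
        simp only [Finset.mem_inter, Finset.mem_filter] at hi
        exact (hw i (by tauto)).le
    calc (X.card : ℝ) * ∑ q ∈ Q with Crosses q t, w q ≤ X.card * (L + L) :=
          mul_le_mul_of_nonneg_left hle hx0.le
      _ = 2 * (s + 2 * k) * W := by rw [hL]; field_simp; ring

/-- The number of the first `j` triangles met by the line `q`. -/
def crossings (T : ℕ → Fin 3 → ℝ × ℝ) (j : ℕ) (q : ℝ × ℝ) : ℕ :=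
  ((Finset.range j).filter fun i => Crosses q (T i)).card

lemma crossings_update (T : ℕ → Fin 3 → ℝ × ℝ) (j : ℕ) (t : Fin 3 → ℝ × ℝ) (q : ℝ × ℝ) :
    crossings (Function.update T j t) (j + 1) q =
      crossings T j q + if Crosses q t then 1 else 0 := by
  have h : (Finset.range j).filter (fun i => Crosses q (Function.update T j t i)) =
      (Finset.range j).filter fun i => Crosses q (T i) := by
    apply Finset.filter_congr
    intro i hi
    rw [Function.update_of_ne (Finset.mem_range.1 hi).ne]
  unfold crossings
  rw [Finset.range_add_one, Finset.filter_insert, Function.update_self, h]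
  split_ifs
  · rw [Finset.card_insert_of_notMem (by simp)]
  · simp

lemma weight_step {W c x κ : ℝ} (hW : 0 ≤ W) (hκ : 0 ≤ κ) (hx : 0 < x) (hκx : κ ≤ x)
    (hc : x * c ≤ 10 * κ * W) : (W + c) * (x - κ) ^ 10 ≤ W * x ^ 10 := by
  set u := κ / x with hu
  have hu0 : 0 ≤ u := by positivity
  have hu1 : u ≤ 1 := (div_le_one hx).2 hκx
  have hκu : κ = u * x := by rw [hu]; field_simp
  have hc' : c ≤ 10 * u * W := by
    refine le_of_mul_le_mul_left ?_ hx
    rw [hκu] at hc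
    linarith
  have h1 : 1 + 10 * u ≤ (1 + u) ^ 10 := by
    have := one_add_mul_le_pow (a := u) (by linarith) 10
    exact_mod_cast this
  have h2 : (1 + 10 * u) * (1 - u) ^ 10 ≤ 1 := by
    calc (1 + 10 * u) * (1 - u) ^ 10 ≤ (1 + u) ^ 10 * (1 - u) ^ 10 :=
          mul_le_mul_of_nonneg_right h1 (by positivity)
      _ = (1 - u ^ 2) ^ 10 := by rw [← mul_pow]; ring
      _ ≤ 1 := pow_le_one₀ (by nlinarith) (by nlinarith)
  have h3 : (x - κ) ^ 10 = (1 - u) ^ 10 * x ^ 10 := by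
    rw [hκu, ← mul_pow]; ring
  rw [h3]
  calc (W + c) * ((1 - u) ^ 10 * x ^ 10) ≤ (W * (1 + 10 * u)) * ((1 - u) ^ 10 * x ^ 10) :=
        mul_le_mul_of_nonneg_right (by linarith) (by positivity)
    _ = W * x ^ 10 * ((1 + 10 * u) * (1 - u) ^ 10) := by ring
    _ ≤ W * x ^ 10 * 1 := mul_le_mul_of_nonneg_left h2 (by positivity)
    _ = W * x ^ 10 := mul_one _

/-- Iterated reweighting: disjoint `k`-subsets of `M` in triangles such that every line of `Q`
meets few of the triangles. -/
lemma exists_greedy_parts (Q : Finset (ℝ × ℝ)) (hQ : Q.Nonempty) (M : Finset (ℝ × ℝ)) (k : ℕ)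
    (hk : 1 ≤ k) (havoid : ∀ q ∈ Q, Avoids M q) (hs : ∀ q ∈ Q, (below M q).card ≤ 3 * k) (j : ℕ)
    (hj : (j + 4) * k ≤ M.card) :
    ∃ (f : ℕ → Finset (ℝ × ℝ)) (T : ℕ → Fin 3 → ℝ × ℝ),
      (∀ i < j, f i ⊆ M ∧ (f i).card = k ∧ ↑(f i) ⊆ triangle (T i) ∧
        ∀ z ∈ triangle (T i), ∃ m ∈ M, ∃ m' ∈ M, m.1 ≤ z.1 ∧ z.1 ≤ m'.1) ∧
      (∀ i < j, ∀ i' < j, i ≠ i' → Disjoint (f i) (f i')) ∧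
      (∑ q ∈ Q, (2 : ℝ) ^ crossings T j q) * (M.card - j * k : ℝ) ^ 10 ≤
        Q.card * (M.card : ℝ) ^ 10 := by
  induction j with
  | zero =>
    refine ⟨fun _ => ∅, fun _ _ => 0, by simp, by simp, ?_⟩
    simp [crossings]
  | succ j ih =>
    obtain ⟨f, T, hf, hdisj, hweight⟩ := ih (le_trans (Nat.mul_le_mul_right k (by omega)) hj)
    set U := (Finset.range j).biUnion f with hU
    have hUM : U ⊆ M := Finset.biUnion_subset.2 fun i hi => (hf i (Finset.mem_range.1 hi)).1
    have hUcard : U.card = j * k := by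
      rw [hU, Finset.card_biUnion]
      · rw [Finset.sum_congr rfl fun i hi => (hf i (Finset.mem_range.1 hi)).2.1]
        simp
      · intro i hi i' hi' hne
        exact hdisj i (Finset.mem_range.1 hi) i' (Finset.mem_range.1 hi') hne
    set X := M \ U with hX
    have hXM : X ⊆ M := Finset.sdiff_subset
    have hXcard : X.card + j * k = M.card := by
      rw [← hUcard]; exact Finset.card_sdiff_add_card_eq_card hUM
    have hXge : 5 * k ≤ X.card := by nlinarith
    obtain ⟨S, hSX, hSk, t, hSt, hstrip, hcross⟩ :=
      exists_lightly_crossed_triangle Q (fun q => 2 ^ crossings T j q) (fun q _ => by positivity)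
        hQ X (3 * k) k hk (fun q hq p hp => havoid q hq p (hXM hp))
        (fun q hq => (Finset.card_le_card (Finset.filter_subset_filter _ hXM)).trans (hs q hq))
        (by omega)
    refine ⟨Function.update f j S, Function.update T j t, ?_, ?_, ?_⟩
    · intro i hi
      rcases (Nat.lt_succ_iff_lt_or_eq.1 hi) with hi | rfl
      · rw [Function.update_of_ne hi.ne, Function.update_of_ne hi.ne]
        exact hf i hi
      · rw [Function.update_self, Function.update_self]
        refine ⟨hSX.trans hXM, hSk, hSt, fun z hz => ?_⟩
        obtain ⟨m, hm, m', hm', h⟩ := hstrip z hz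
        exact ⟨m, hXM hm, m', hXM hm', h⟩
    · have hS : ∀ i < j, Disjoint (f i) S := by
        intro i hi
        refine Finset.disjoint_of_subset_right hSX ?_
        refine Finset.disjoint_of_subset_left ?_ Finset.disjoint_sdiff
        exact Finset.subset_biUnion_of_mem f (Finset.mem_range.2 hi)
      intro i hi i' hi' hne
      rcases (Nat.lt_succ_iff_lt_or_eq.1 hi) with hi | rfl <;>
        rcases (Nat.lt_succ_iff_lt_or_eq.1 hi') with hi' | rfl
      · rw [Function.update_of_ne hi.ne, Function.update_of_ne hi'.ne]
        exact hdisj i hi i' hi' hne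
      · rw [Function.update_of_ne hi.ne, Function.update_self]
        exact hS i hi
      · rw [Function.update_of_ne hi'.ne, Function.update_self]
        exact (hS i' hi').symm
      · exact absurd rfl hne
    · have hsum : ∑ q ∈ Q, (2 : ℝ) ^ crossings (Function.update T j t) (j + 1) q =
          ∑ q ∈ Q, (2 : ℝ) ^ crossings T j q +
            ∑ q ∈ Q with Crosses q t, (2 : ℝ) ^ crossings T j q := by
        rw [Finset.sum_filter, ← Finset.sum_add_distrib]
        apply Finset.sum_congr rfl
        intro q _
        rw [crossings_update]
        split_ifs
        · ring
        · simp
      have hXr : (X.card : ℝ) = M.card - j * k := by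
        rw [← hXcard]; push_cast; ring
      have hkX : (5 * k : ℝ) ≤ X.card := by exact_mod_cast hXge
      have hk0 : (1 : ℝ) ≤ k := by exact_mod_cast hk
      have hsub : (M.card - ((j + 1 : ℕ) : ℝ) * k : ℝ) = X.card - k := by
        rw [hXr]; push_cast; ring
      rw [hsum, hsub]
      rw [← hXr] at hweight
      refine le_trans (weight_step (Finset.sum_nonneg fun q _ => by positivity) (by linarith)
        (by linarith) (by linarith) ?_) hweight
      refine hcross.trans (le_of_eq ?_)
      push_cast
      ring

/-- In general position, every slope admits a line with `K` or `K + 1` points below. -/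
lemma exists_line_of_slope {P : Finset (ℝ × ℝ)} (hP : GenPos2 P) {K : ℕ} (hK : 1 ≤ K)
    (hKP : K ≤ P.card) (a : ℝ) :
    ∃ b, Avoids P (a, b) ∧ K ≤ (below P (a, b)).card ∧ (below P (a, b)).card ≤ K + 1 := by
  set v : ℝ × ℝ → ℝ := fun p => p.2 - a * p.1 with hv
  have hPne : P.Nonempty := Finset.card_pos.1 (by omega)
  set V := P.filter fun p => K ≤ (P.filter fun q => v q ≤ v p).card with hV
  have hVne : V.Nonempty := by
    obtain ⟨p, hp, hmax⟩ := P.exists_max_image v hPne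
    refine ⟨p, Finset.mem_filter.2 ⟨hp, ?_⟩⟩
    rwa [Finset.filter_true_of_mem hmax]
  obtain ⟨p, hpV, hmin⟩ := V.exists_min_image v hVne
  rw [hV, Finset.mem_filter] at hpV
  have hlt : (P.filter fun q => v q < v p).card < K := by
    rcases (P.filter fun q => v q < v p).eq_empty_or_nonempty with h | h
    · rw [h, Finset.card_empty]; omega
    · obtain ⟨q, hq, hqmax⟩ := Finset.exists_max_image _ v h
      rw [Finset.mem_filter] at hq
      by_contra! hcon
      refine absurd (hmin q (Finset.mem_filter.2 ⟨hq.1, hcon.trans (Finset.card_le_card ?_)⟩))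
        (not_le.2 hq.2)
      intro r hr
      exact Finset.mem_filter.2 ⟨(Finset.mem_filter.1 hr).1, hqmax r hr⟩
  have heq : (P.filter fun q => v q = v p).card ≤ 2 := by
    by_contra! hcon
    obtain ⟨x, y, z, hx, hy, hz, hxy, hxz, hyz⟩ := Finset.two_lt_card_iff.1 hcon
    rw [Finset.mem_filter] at hx hy hz
    refine hP x hx.1 y hy.1 z hz.1 hxy hyz hxz ?_
    rw [collinear_iff_of_mem (p₀ := x) (by simp)]
    refine ⟨(1, a), ?_⟩
    have hw : ∀ w : ℝ × ℝ, v w = v p → w = (w.1 - x.1) • ((1, a) : ℝ × ℝ) +ᵥ x := by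
      intro w hw
      have hwx : v w = v x := hw.trans hx.2.symm
      simp only [hv] at hwx
      ext
      · simp
      · simp; linarith
    rintro w (rfl | rfl | rfl)
    · exact ⟨_, hw _ hx.2⟩
    · exact ⟨_, hw _ hy.2⟩
    · exact ⟨_, hw _ hz.2⟩
  have hle : (P.filter fun q => v q ≤ v p).card ≤ K + 1 := by
    have : (P.filter fun q => v q ≤ v p) ⊆
        (P.filter fun q => v q < v p) ∪ P.filter fun q => v q = v p := by
      intro q hq
      simp only [Finset.mem_union, Finset.mem_filter] at hq ⊢
      rcases hq.2.lt_or_eq with h | h <;> tauto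
    have h1 := Finset.card_le_card this
    have h2 := Finset.card_union_le (P.filter fun q => v q < v p) (P.filter fun q => v q = v p)
    omega
  obtain ⟨b, hb, hbgap⟩ : ∃ b, v p < b ∧ ∀ q ∈ P, v p < v q → b < v q := by
    rcases (P.filter fun q => v p < v q).eq_empty_or_nonempty with h | h
    · refine ⟨v p + 1, by linarith, fun q hq hpq => ?_⟩
      exact absurd (Finset.filter_eq_empty_iff.1 h hq) (not_not.2 hpq)
    · obtain ⟨q, hq, hqmin⟩ := Finset.exists_min_image _ v h
      rw [Finset.mem_filter] at hq
      obtain ⟨b, hb1, hb2⟩ := exists_between hq.2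
      exact ⟨b, hb1, fun r hr hpr => hb2.trans_le (hqmin r (Finset.mem_filter.2 ⟨hr, hpr⟩))⟩
  have hbelow : below P (a, b) = P.filter fun q => v q ≤ v p := by
    apply Finset.filter_congr
    intro q hq
    constructor
    · intro h
      by_contra! hcon
      have := hbgap q hq hcon
      simp only [hv, lineAt] at *
      linarith
    · intro h
      simp only [hv, lineAt] at *
      linarith
  refine ⟨b, fun q hq h => ?_, by rw [hbelow]; exact hpV.2, by rw [hbelow]; exact hle⟩
  have hqb : v q = b := by simp only [hv, lineAt] at *; linarith
  have := hbgap q hq (by rw [hqb]; exact hb)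
  linarith

/-- The set of points below a line is stable under small rotations of the line. -/
lemma eventually_below_eq {P : Finset (ℝ × ℝ)} {a b : ℝ} (h : Avoids P (a, b)) :
    ∀ᶠ a' in nhds a, Avoids P (a', b) ∧ below P (a', b) = below P (a, b) := by
  have key : ∀ p ∈ P, ∀ᶠ a' in nhds a,
      p.2 ≠ lineAt (a', b) p.1 ∧ (p.2 < lineAt (a', b) p.1 ↔ p.2 < lineAt (a, b) p.1) := by
    intro p hp
    have hcont : Continuous fun a' : ℝ => lineAt (a', b) p.1 := by unfold lineAt; fun_prop
    rcases lt_or_gt_of_ne (h p hp) with hlt | hgt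
    · filter_upwards [hcont.continuousAt.eventually (lt_mem_nhds hlt)] with a' ha'
      exact ⟨ha'.ne, iff_of_true ha' hlt⟩
    · filter_upwards [hcont.continuousAt.eventually (gt_mem_nhds hgt)] with a' ha'
      exact ⟨ha'.ne', iff_of_false (not_lt.2 ha'.le) (not_lt.2 hgt.le)⟩
  filter_upwards [(Finset.eventually_all P).2 key] with a' ha'
  exact ⟨fun p hp => (ha' p hp).1, Finset.filter_congr fun p hp => (ha' p hp).2⟩

lemma below_mono {P : Finset (ℝ × ℝ)} {a b b' : ℝ} (h : b ≤ b') :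
    below P (a, b) ⊆ below P (a, b') := by
  intro p hp
  simp only [mem_below, lineAt] at hp ⊢
  exact ⟨hp.1, by linarith⟩

/-- A rotating family of lines, each with `K` or `K + 1` points below, in which consecutive lines
share at least `K` points below. -/
lemma exists_rotating_lines {P : Finset (ℝ × ℝ)} (hP : GenPos2 P) {K : ℕ} (hK : 1 ≤ K)
    (hKP : K ≤ P.card) {A : ℝ} (hA : 0 ≤ A) :
    ∃ (u : ℕ → ℝ × ℝ) (M : ℕ), (Monotone fun i => (u i).1) ∧ (u 0).1 = -A ∧ (u M).1 = A ∧
      ∀ i, Avoids P (u i) ∧ K ≤ (below P (u i)).card ∧ (below P (u i)).card ≤ K + 1 ∧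
        K ≤ (below P (u i) ∩ below P (u (i + 1))).card := by
  choose b hb using exists_line_of_slope hP hK hKP
  have hnhds : ∀ c, ∃ ε > 0, ∀ a ∈ Metric.ball c ε,
      Avoids P (a, b c) ∧ below P (a, b c) = below P (c, b c) := fun c =>
    Metric.eventually_nhds_iff_ball.1 (eventually_below_eq (hb c).1)
  choose ε hε hball using hnhds
  obtain ⟨t, ht0, htmono, ⟨M, hM⟩, ht⟩ := exists_monotone_Icc_subset_open_cover_Icc
    (a := -A) (b := A) (by linarith)
    (c := fun c : ℝ => Subtype.val ⁻¹' Metric.ball c (ε c))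
    (fun c => Metric.isOpen_ball.preimage continuous_subtype_val)
    (fun x _ => Set.mem_iUnion.2 ⟨x.1, Metric.mem_ball_self (hε _)⟩)
  choose c hc using ht
  have hleft : ∀ i, (t i : ℝ) ∈ Metric.ball (c i) (ε (c i)) := fun i =>
    hc i ⟨le_rfl, htmono (Nat.le_succ i)⟩
  have hright : ∀ i, (t (i + 1) : ℝ) ∈ Metric.ball (c i) (ε (c i)) := fun i =>
    hc i ⟨htmono (Nat.le_succ i), le_rfl⟩
  refine ⟨fun i => (t i, b (c i)), M, fun i j hij => htmono hij, ht0, hM M le_rfl, fun i => ?_⟩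
  have hi := hball _ _ (hleft i)
  have hi' := hball _ _ (hleft (i + 1))
  refine ⟨hi.1, by rw [hi.2]; exact (hb _).2.1, by rw [hi.2]; exact (hb _).2.2, ?_⟩
  rw [hi.2, ← (hball _ _ (hright i)).2]
  rcases le_total (b (c i)) (b (c (i + 1))) with h | h
  · rw [Finset.inter_eq_left.2 (below_mono h), (hball _ _ (hright i)).2]
    exact (hb _).2.1
  · rw [Finset.inter_eq_right.2 (below_mono h), hi'.2]
    exact (hb _).2.1

/-- Joining a point below one line and above another to a point above the first and below the
second gives a slope strictly between those of the two lines. -/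
lemma slope_between {P : Finset (ℝ × ℝ)} {q q' d e : ℝ × ℝ} (hq : Avoids P q) (hq' : Avoids P q')
    (hqq' : q.1 ≤ q'.1) (hd : d ∈ below P q \ below P q') (he : e ∈ below P q' \ below P q) :
    d.1 < e.1 ∧ q.1 * (e.1 - d.1) < e.2 - d.2 ∧ e.2 - d.2 < q'.1 * (e.1 - d.1) := by
  simp only [Finset.mem_sdiff, mem_below, not_and, not_lt] at hd he
  have h1 := lt_of_le_of_ne (hd.2 hd.1.1) (hq' d hd.1.1).symm
  have h2 := lt_of_le_of_ne (he.2 he.1.1) (hq e he.1.1).symm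
  have h3 := hd.1.2
  have h4 := he.1.2
  simp only [lineAt] at h1 h2 h3 h4
  have h5 : q.1 * (e.1 - d.1) < e.2 - d.2 := by linarith
  have h6 : e.2 - d.2 < q'.1 * (e.1 - d.1) := by linarith
  refine ⟨?_, h5, h6⟩
  by_contra! hcon
  nlinarith [mul_nonneg (sub_nonneg.2 hqq') (sub_nonneg.2 hcon)]

/-- Lines of increasing slope that exchange at least `k` points at each step are few, since every
pair of points is exchanged at most once. -/
lemma card_exchange_le {P : Finset (ℝ × ℝ)} {k N : ℕ} {v : ℕ → ℝ × ℝ}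
    (hmono : Monotone fun i => (v i).1) (hv : ∀ i, Avoids P (v i))
    (hleft : ∀ i < N, k ≤ (below P (v i) \ below P (v (i + 1))).card)
    (hright : ∀ i < N, k ≤ (below P (v (i + 1)) \ below P (v i)).card) :
    N * k ^ 2 ≤ P.card ^ 2 := by
  set F : ℕ → Finset ((ℝ × ℝ) × (ℝ × ℝ)) := fun i =>
    (below P (v i) \ below P (v (i + 1))) ×ˢ (below P (v (i + 1)) \ below P (v i)) with hF
  have hFcard : ∀ i < N, k ^ 2 ≤ (F i).card := fun i hi => by
    rw [hF, Finset.card_product, sq]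
    exact Nat.mul_le_mul (hleft i hi) (hright i hi)
  have hdisj_lt : ∀ i j, i < j → Disjoint (F i) (F j) := by
    intro i j hij
    rw [Finset.disjoint_left]
    rintro ⟨d, e⟩ hi hj
    rw [hF, Finset.mem_product] at hi hj
    obtain ⟨hx, -, h1⟩ := slope_between (hv _) (hv _) (hmono (Nat.le_succ i)) hi.1 hi.2
    obtain ⟨-, h2, -⟩ := slope_between (hv _) (hv _) (hmono (Nat.le_succ j)) hj.1 hj.2
    have := mul_le_mul_of_nonneg_right (hmono (Nat.succ_le_of_lt hij)) (sub_nonneg.2 hx.le)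
    simp only at this h1 h2
    linarith
  have hsub : (Finset.range N).biUnion F ⊆ P ×ˢ P := by
    refine Finset.biUnion_subset.2 fun i _ => Finset.product_subset_product ?_ ?_ <;>
      exact Finset.sdiff_subset.trans (below_subset _ _)
  have hcard := Finset.card_le_card hsub
  rw [Finset.card_biUnion, Finset.card_product, ← sq] at hcard
  · refine le_trans ?_ hcard
    calc N * k ^ 2 = ∑ _i ∈ Finset.range N, k ^ 2 := by simp
      _ ≤ _ := Finset.sum_le_sum fun i hi => hFcard i (Finset.mem_range.1 hi)
  · intro i _ j _ hne
    rcases lt_or_gt_of_ne hne with h | h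
    · exact hdisj_lt i j h
    · exact (hdisj_lt j i h).symm

/-- A relation linking consecutive indices up to `M` admits a greedy linked sequence from `0`, which
stays at `M` once there, and in which no two-step jump is linked before that. -/
lemma exists_greedy_sequence (r : ℕ → ℕ → Prop) (M : ℕ) (hrefl : ∀ i, r i i)
    (hsucc : ∀ i, r i (i + 1)) :
    ∃ s : ℕ → ℕ, s 0 = 0 ∧ Monotone s ∧ (∀ m, s m ≤ M) ∧ (∀ m, r (s m) (s (m + 1))) ∧
      ∀ m, s (m + 1) < M → ¬ r (s m) (s (m + 2)) := by
  set next : ℕ → ℕ := fun i => Nat.findGreatest (r i) M with hnext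
  have hle : ∀ i ≤ M, i ≤ next i := fun i hi => Nat.le_findGreatest hi (hrefl i)
  have hM : ∀ m, next^[m] 0 ≤ M := by
    intro m
    cases m with
    | zero => simp
    | succ m =>
      rw [Function.iterate_succ_apply']
      exact Nat.findGreatest_le M
  refine ⟨fun m => next^[m] 0, rfl, monotone_nat_of_le_succ fun m => ?_, hM, fun m => ?_,
    fun m hm => ?_⟩
  · rw [Function.iterate_succ_apply']
    exact hle _ (hM m)
  · change r (next^[m] 0) (next^[m + 1] 0)
    rw [Function.iterate_succ_apply']
    exact Nat.findGreatest_spec (hM m) (hrefl _)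
  · apply Nat.findGreatest_is_greatest (n := M) _ (hM _)
    change next (next^[m] 0) < _
    rw [← Function.iterate_succ_apply' next m 0]
    rw [Function.iterate_succ_apply' next (m + 1) 0]
    exact lt_of_lt_of_le (Nat.lt_succ_self _) (Nat.le_findGreatest hm (hsucc _))

/-- If two lines share more than `k` points below them, then a line of intermediate slope with at
most `k` points below it is below their upper envelope. -/
lemma le_envelope {P : Finset (ℝ × ℝ)} {k : ℕ} {l q q' : ℝ × ℝ} (hl : (below P l).card ≤ k)
    (hq : q.1 ≤ l.1) (hq' : l.1 ≤ q'.1) (hk : k < (below P q ∩ below P q').card) (x : ℝ) :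
    lineAt l x ≤ lineAt q x ∨ lineAt l x ≤ lineAt q' x := by
  by_contra! hcon
  refine absurd (hk.trans_le ((Finset.card_le_card fun p hp => ?_).trans hl)) (lt_irrefl k)
  simp only [Finset.mem_inter, mem_below, lineAt] at hp hcon ⊢
  refine ⟨hp.1.1, ?_⟩
  rcases le_total x p.1 with h | h
  · nlinarith [mul_nonneg (sub_nonneg.2 hq) (sub_nonneg.2 h)]
  · nlinarith [mul_nonneg (sub_nonneg.2 hq') (sub_nonneg.2 h)]

lemma exists_slope_bound (P : Finset (ℝ × ℝ)) :
    ∃ A : ℝ, 0 ≤ A ∧ ∀ p ∈ P, ∀ q ∈ P, p.1 < q.1 → |q.2 - p.2| ≤ A * (q.1 - p.1) := by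
  refine ⟨∑ z ∈ P ×ˢ P, |(z.2.2 - z.1.2) / (z.2.1 - z.1.1)|,
    Finset.sum_nonneg fun _ _ => abs_nonneg _, fun p hp q hq hpq => ?_⟩
  have hpos : 0 < q.1 - p.1 := sub_pos.2 hpq
  rw [← div_le_iff₀ hpos]
  refine le_trans (le_of_eq ?_) (Finset.single_le_sum
    (f := fun z : (ℝ × ℝ) × (ℝ × ℝ) => |(z.2.2 - z.1.2) / (z.2.1 - z.1.1)|)
    (fun _ _ => abs_nonneg _) (Finset.mk_mem_product hp hq))
  rw [abs_div, abs_of_pos hpos]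

/-- A small family of test lines such that, away from few extreme points, every line with at most
`k` points below is under the upper envelope of two test lines. -/
lemma exists_test_lines {P : Finset (ℝ × ℝ)} (hP : GenPos2 P) {k : ℕ} (hk : 1 ≤ k)
    (hkP : 2 * k ≤ P.card) :
    ∃ Q : Finset (ℝ × ℝ), Q.Nonempty ∧ Q.card ≤ 2 * (P.card / k + 1) ^ 2 + 1 ∧
      (∀ q ∈ Q, Avoids P q ∧ (below P q).card ≤ 2 * k + 1) ∧
      ∃ M ⊆ P, P.card ≤ M.card + 2 * (2 * k + 1) ∧
        ∀ l, (below P l).card ≤ k → ∃ q ∈ Q, ∃ q' ∈ Q, ∀ x,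
          (∃ m ∈ M, ∃ m' ∈ M, m.1 ≤ x ∧ x ≤ m'.1) →
            lineAt l x ≤ lineAt q x ∨ lineAt l x ≤ lineAt q' x := by
  obtain ⟨A, hA, hslope⟩ := exists_slope_bound P
  obtain ⟨u, M, humono, hu0, huM, hu⟩ :=
    exists_rotating_lines hP (show 1 ≤ 2 * k by omega) hkP hA
  obtain ⟨s, hs0, hsmono, hsM, hsr, hsnr⟩ := exists_greedy_sequence
    (fun i j => k < (below P (u i) ∩ below P (u j)).card) M
    (fun i => by rw [Finset.inter_self]; have := (hu i).2.1; omega)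
    (fun i => by have := (hu i).2.2.2; omega)
  set N := (P.card / k + 1) ^ 2 with hN
  have hend : s (2 * N) = M := by
    by_contra hne
    have hlt : ∀ m ≤ 2 * N, s m < M := fun m hm =>
      (hsmono hm).trans_lt (lt_of_le_of_ne (hsM _) hne)
    have hinter : ∀ i < N, (below P (u (s (2 * i))) ∩ below P (u (s (2 * (i + 1))))).card ≤ k :=
      fun i hi => not_lt.1 (hsnr (2 * i) (hlt _ (by omega)))
    have hcard := card_exchange_le (P := P) (k := k) (N := N) (v := fun i => u (s (2 * i)))
      (fun i j hij => humono (hsmono (by omega))) (fun i => (hu _).1)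
      (fun i hi => by
        have h1 := hinter i hi
        have h2 := (hu (s (2 * i))).2.1
        have h3 := Finset.card_sdiff_add_card_inter (below P (u (s (2 * i))))
          (below P (u (s (2 * (i + 1)))))
        omega)
      (fun i hi => by
        have h1 := hinter i hi
        rw [Finset.inter_comm] at h1
        have h2 := (hu (s (2 * (i + 1)))).2.1
        have h3 := Finset.card_sdiff_add_card_inter (below P (u (s (2 * (i + 1)))))
          (below P (u (s (2 * i))))
        omega)
    have hlt' : P.card < (P.card / k + 1) * k := by
      rw [mul_comm]; exact Nat.lt_mul_div_succ _ (by omega)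
    have := Nat.pow_lt_pow_left hlt' (n := 2) (by norm_num)
    rw [mul_pow, ← hN] at this
    omega
  set Q := (Finset.range (2 * N + 1)).image fun m => u (s m) with hQ
  have hmem : ∀ m ≤ 2 * N, u (s m) ∈ Q := fun m hm =>
    Finset.mem_image.2 ⟨m, Finset.mem_range.2 (by omega), rfl⟩
  refine ⟨Q, ⟨_, hmem 0 (by omega)⟩, Finset.card_image_le.trans (by simp), ?_,
    P \ (below P (u 0) ∪ below P (u M)), Finset.sdiff_subset, ?_, ?_⟩
  · intro q hq
    obtain ⟨m, -, rfl⟩ := Finset.mem_image.1 hq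
    exact ⟨(hu _).1, (hu _).2.2.1⟩
  · have h1 := Finset.card_sdiff_add_card_eq_card
      (Finset.union_subset (below_subset P (u 0)) (below_subset P (u M)))
    have h2 := Finset.card_union_le (below P (u 0)) (below P (u M))
    have h3 := (hu 0).2.2.1
    have h4 := (hu M).2.2.1
    omega
  · intro l hl
    have hescape : ∀ i, ∃ e ∈ below P (u i), lineAt l e.1 ≤ e.2 := by
      intro i
      by_contra! hcon
      have := Finset.card_le_card (fun p hp => mem_below.2 ⟨below_subset P _ hp, hcon p hp⟩ :
        below P (u i) ⊆ below P l)
      have := (hu i).2.1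
      omega
    have hQ0 : u 0 ∈ Q := by
      have := hmem 0 (by omega)
      rwa [hs0] at this
    have hQM : u M ∈ Q := by
      have := hmem (2 * N) le_rfl
      rwa [hend] at this
    have habove : ∀ {m}, m ∈ P \ (below P (u 0) ∪ below P (u M)) →
        m ∈ P ∧ lineAt (u 0) m.1 ≤ m.2 ∧ lineAt (u M) m.1 ≤ m.2 := by
      intro m hm
      simp only [Finset.mem_sdiff, Finset.mem_union, mem_below, not_or, not_and, not_lt] at hm
      exact ⟨hm.1, hm.2.1 hm.1, hm.2.2 hm.1⟩
    rcases lt_or_ge l.1 (-A) with hlo | hlo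
    · refine ⟨u 0, hQ0, u 0, hQ0, fun x ⟨m, hm, _, _, hmx, _⟩ => Or.inl ?_⟩
      obtain ⟨e, he, hel⟩ := hescape 0
      rw [mem_below] at he
      obtain ⟨hmP, hm0, -⟩ := habove hm
      have hem : e.1 ≤ m.1 := by
        by_contra! hcon
        have := (abs_le.1 (hslope m hmP e he.1 hcon)).1
        have h := he.2
        simp only [lineAt, hu0] at h hm0
        nlinarith
      have h := he.2
      simp only [lineAt, hu0] at h hel ⊢
      nlinarith [mul_nonneg (sub_nonneg.2 hlo.le) (sub_nonneg.2 (hem.trans hmx))]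
    rcases lt_or_ge A l.1 with hhi | hhi
    · refine ⟨u M, hQM, u M, hQM, fun x ⟨_, _, m, hm, _, hxm⟩ => Or.inl ?_⟩
      obtain ⟨e, he, hel⟩ := hescape M
      rw [mem_below] at he
      obtain ⟨hmP, -, hmM⟩ := habove hm
      have hem : m.1 ≤ e.1 := by
        by_contra! hcon
        have := (abs_le.1 (hslope e he.1 m hmP hcon)).2
        have h := he.2
        simp only [lineAt, huM] at h hmM
        nlinarith
      have h := he.2
      simp only [lineAt, huM] at h hel ⊢
      nlinarith [mul_nonneg (sub_nonneg.2 hhi.le) (sub_nonneg.2 (hxm.trans hem))]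
    · have hex : ∃ m, l.1 ≤ (u (s m)).1 := ⟨2 * N, by rw [hend, huM]; exact hhi⟩
      have hfind := Nat.find_spec hex
      have hfind_le : Nat.find hex ≤ 2 * N := Nat.find_min' hex (by rw [hend, huM]; exact hhi)
      rcases Nat.eq_zero_or_pos (Nat.find hex) with h0 | hpos
      · rw [h0, hs0, hu0] at hfind
        refine ⟨u 0, hQ0, u 0, hQ0, fun x _ => ?_⟩
        refine le_envelope hl (hu0.trans_le hlo) (hfind.trans hu0.ge) ?_ x
        rw [Finset.inter_self]
        have := (hu 0).2.1
        omega
      · obtain ⟨m, hm⟩ := Nat.exists_eq_add_of_lt hpos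
        rw [zero_add] at hm
        rw [hm] at hfind hfind_le
        have hlt : (u (s m)).1 < l.1 := not_le.1 (Nat.find_min hex (by omega))
        exact ⟨_, hmem m (by omega), _, hmem (m + 1) hfind_le,
          fun x _ => le_envelope hl hlt.le hfind (hsr m) x⟩

/-- A finite set splits into consecutive chunks of size `k`, up to a smaller last one. -/
lemma exists_chunks {α : Type*} (R : Finset α) {k : ℕ} (hk : 1 ≤ k) :
    ∃ g : ℕ → Finset α, (∀ i < R.card / k, (g i).card = k) ∧
      (∀ i j, i ≠ j → Disjoint (g i) (g j)) ∧ (∀ i, g i ⊆ R) ∧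
      ∀ p ∈ R, ∃ i < (R.card + k - 1) / k, p ∈ g i := by
  set idx : R → ℕ := fun p => (R.equivFin p : ℕ) with hidx
  have hidx_inj : Function.Injective idx := fun p q h => R.equivFin.injective (Fin.ext h)
  refine ⟨fun i => (R.attach.filter fun p => idx p / k = i).map (Function.Embedding.subtype _),
    fun i hi => ?_, fun i j hij => ?_, fun i p hp => ?_, fun p hp => ?_⟩
  · rw [Finset.card_map, ← Finset.card_image_of_injective _ hidx_inj]
    have : (R.attach.filter fun p => idx p / k = i).image idx =
        Finset.Ico (i * k) (i * k + k) := by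
      ext m
      simp only [Finset.mem_image, Finset.mem_filter, Finset.mem_attach, true_and, Finset.mem_Ico]
      rw [show (i * k ≤ m ∧ m < i * k + k) ↔ m / k = i by
        rw [Nat.div_eq_iff (by omega)]; omega]
      constructor
      · rintro ⟨p, hp, rfl⟩
        exact hp
      · intro hm
        have hmR : m < R.card := Nat.lt_of_div_lt_div (hm.trans_lt hi)
        exact ⟨R.equivFin.symm ⟨m, hmR⟩, by simp [hidx, hm], by simp [hidx]⟩
    rw [this]
    simp
  · rw [Finset.disjoint_map, Finset.disjoint_filter]
    intro p _ hpi hpj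
    exact hij (hpi.symm.trans hpj)
  · obtain ⟨q, -, rfl⟩ := Finset.mem_map.1 hp
    exact q.2
  · refine ⟨idx ⟨p, hp⟩ / k, ?_, Finset.mem_map.2 ⟨⟨p, hp⟩, by simp, rfl⟩⟩
    have hlt : idx ⟨p, hp⟩ < R.card := (R.equivFin ⟨p, hp⟩).2
    rw [Nat.lt_iff_add_one_le, ← Nat.add_div_right _ (by omega)]
    exact Nat.div_le_div_right (by omega)

lemma exists_triangle_superset (P : Finset (ℝ × ℝ)) :
    ∃ t : Fin 3 → ℝ × ℝ, ↑P ⊆ triangle t := by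
  obtain ⟨R, hR0, hR⟩ : ∃ R : ℝ, 0 < R ∧ ∀ p ∈ P, |p.1| ≤ R ∧ |p.2| ≤ R := by
    obtain ⟨R, hR⟩ := (P.finite_toSet.isBounded).exists_norm_le
    refine ⟨max R 1, by positivity, fun p hp => ?_⟩
    have h := (hR p hp).trans (le_max_left R 1)
    exact ⟨(norm_fst_le p).trans h, (norm_snd_le p).trans h⟩
  refine ⟨![(-4 * R, -R), (4 * R, -R), (0, 3 * R)], fun p hp => ?_⟩
  obtain ⟨h1, h2⟩ := hR p hp
  rw [abs_le] at h1 h2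
  obtain ⟨u, hu⟩ : ∃ u, p.1 = u * (4 * R) := ⟨p.1 / (4 * R), by field_simp⟩
  obtain ⟨v, hv⟩ : ∃ v, p.2 = v * (4 * R) - R := ⟨(p.2 + R) / (4 * R), by field_simp; ring⟩
  rw [hu] at h1
  rw [hv] at h2
  have hu1 : -1 / 4 ≤ u := by nlinarith
  have hu2 : u ≤ 1 / 4 := by nlinarith
  have hv1 : 0 ≤ v := by nlinarith
  have hv2 : v ≤ 1 / 2 := by nlinarith
  convert combination_mem_triangle (t := ![(-4 * R, -R), (4 * R, -R), (0, 3 * R)])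
    (α := (1 - v - u) / 2) (β := (1 - v + u) / 2) (γ := v)
    (by linarith) (by linarith) hv1 (by ring) using 1
  ext
  · simp [hu]; ring
  · simp [hv]; ring

/-- Disjoint `k`-subsets in triangles extend to a `k`-partition. -/
lemma exists_isKPartition_extending {n k : ℕ} {P : Finset (ℝ × ℝ)} (hn : P.card = n) (hk : 1 ≤ k)
    (f : ℕ → Finset (ℝ × ℝ)) (T : ℕ → Fin 3 → ℝ × ℝ) (j : ℕ) (hj : j ≤ n / k)
    (hf : ∀ i < j, f i ⊆ P ∧ (f i).card = k ∧ ↑(f i) ⊆ triangle (T i))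
    (hdisj : ∀ i < j, ∀ i' < j, i ≠ i' → Disjoint (f i) (f i')) :
    ∃ (parts : Fin ((n + k - 1) / k) → Finset (ℝ × ℝ))
      (tri : Fin ((n + k - 1) / k) → Fin 3 → ℝ × ℝ),
      IsKPartition P n k parts tri ∧
        ∀ a b, crossCount tri a b ≤ crossings T j (a, b) + ((n + k - 1) / k - j) := by
  set U := (Finset.range j).biUnion f with hU
  have hUP : U ⊆ P := Finset.biUnion_subset.2 fun i hi => (hf i (Finset.mem_range.1 hi)).1
  have hfU : ∀ i < j, f i ⊆ U := fun i hi => Finset.subset_biUnion_of_mem f (Finset.mem_range.2 hi)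
  have hUcard : U.card = k * j := by
    rw [hU, Finset.card_biUnion]
    · rw [Finset.sum_congr rfl fun i hi => (hf i (Finset.mem_range.1 hi)).2.1]
      simp [mul_comm]
    · intro i hi i' hi' hne
      exact hdisj i (Finset.mem_range.1 hi) i' (Finset.mem_range.1 hi') hne
  have hkj : k * j ≤ n := (Nat.mul_le_mul_left k hj).trans (Nat.mul_div_le n k)
  have hRcard : (P \ U).card = n - k * j := by
    rw [Finset.card_sdiff_of_subset hUP, hn, hUcard]
  obtain ⟨g, hg, hgdisj, hgR, hgcover⟩ := exists_chunks (P \ U) hk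
  rw [hRcard] at hg hgcover
  have hceil : (n - k * j + k - 1) / k = (n + k - 1) / k - j := by
    rw [← Nat.sub_mul_div]
    congr 1
    omega
  rw [Nat.sub_mul_div] at hg
  rw [hceil] at hgcover
  have hjceil : j ≤ (n + k - 1) / k := hj.trans (Nat.div_le_div_right (by omega))
  obtain ⟨t, ht⟩ := exists_triangle_superset P
  have hfg : ∀ i < j, ∀ i', Disjoint (f i) (g i') := fun i hi i' =>
    Finset.disjoint_of_subset_right (hgR i')
      (Finset.disjoint_of_subset_left (hfU i hi) Finset.disjoint_sdiff)
  refine ⟨fun i => if (i : ℕ) < j then f i else g (i - j), fun i => if (i : ℕ) < j then T i else t,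
    ⟨?_, ?_, ?_, ?_⟩, ?_⟩
  · intro i i' hne
    have hne' : (i : ℕ) ≠ i' := fun h => hne (Fin.ext h)
    split_ifs with hi hi' hi'
    · exact hdisj _ hi _ hi' hne'
    · exact hfg _ hi _
    · exact (hfg _ hi' _).symm
    · exact hgdisj _ _ (by omega)
  · apply Finset.Subset.antisymm
    · refine Finset.biUnion_subset.2 fun i _ => ?_
      split_ifs with hi
      · exact (hf i hi).1
      · exact (hgR _).trans Finset.sdiff_subset
    · intro p hp
      rw [Finset.mem_biUnion]
      by_cases hpU : p ∈ U
      · obtain ⟨i, hi, hpi⟩ := Finset.mem_biUnion.1 hpU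
        rw [Finset.mem_range] at hi
        exact ⟨⟨i, by omega⟩, Finset.mem_univ _, by simpa [hi] using hpi⟩
      · obtain ⟨i, hi, hpi⟩ := hgcover p (Finset.mem_sdiff.2 ⟨hp, hpU⟩)
        exact ⟨⟨j + i, by omega⟩, Finset.mem_univ _, by simpa using hpi⟩
  · intro i hi
    split_ifs with hij
    · exact (hf i hij).2.1
    · exact hg _ (by omega)
  · intro i
    split_ifs with hij
    · exact (hf i hij).2.2
    · exact (Finset.coe_subset.2 ((hgR _).trans Finset.sdiff_subset)).trans ht
  · intro a b
    have hcard : (Finset.Ico j ((n + k - 1) / k)).card = (n + k - 1) / k - j := Nat.card_Ico _ _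
    rw [← hcard]
    refine le_trans ?_ (Finset.card_union_le _ _)
    refine Finset.card_le_card_of_injOn Fin.val (fun i hi => ?_) Fin.val_injective.injOn
    simp only [Finset.coe_filter, Finset.mem_univ, true_and, Set.mem_ofPred_eq] at hi
    simp only [Finset.coe_union, Set.mem_union, Finset.mem_coe, Finset.mem_filter,
      Finset.mem_range, Finset.mem_Ico]
    by_cases hij : (i : ℕ) < j
    · rw [if_pos hij] at hi
      exact Or.inl ⟨hij, hi⟩
    · exact Or.inr ⟨not_lt.1 hij, i.2⟩

/-- At most three of the disjoint `k`-sets lie below a line with at most `3 * k` points below. -/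
lemma card_parts_below_le {P : Finset (ℝ × ℝ)} {k j : ℕ} (hk : 1 ≤ k) {f : ℕ → Finset (ℝ × ℝ)}
    (hf : ∀ i < j, (f i).card = k)
    (hdisj : ∀ i < j, ∀ i' < j, i ≠ i' → Disjoint (f i) (f i')) {q : ℝ × ℝ}
    (hq : (below P q).card ≤ 3 * k) :
    ((Finset.range j).filter fun i => f i ⊆ below P q).card ≤ 3 := by
  set I := (Finset.range j).filter fun i => f i ⊆ below P q with hI
  have hlt : ∀ i ∈ I, i < j := fun i hi => Finset.mem_range.1 (Finset.mem_filter.1 hi).1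
  have hsub : I.biUnion f ⊆ below P q :=
    Finset.biUnion_subset.2 fun i hi => (Finset.mem_filter.1 hi).2
  have hcard := (Finset.card_le_card hsub).trans hq
  rw [Finset.card_biUnion fun i hi i' hi' hne => hdisj i (hlt i hi) i' (hlt i' hi') hne,
    Finset.sum_congr rfl fun i hi => hf i (hlt i hi)] at hcard
  simp only [Finset.sum_const, smul_eq_mul] at hcard
  exact le_of_mul_le_mul_right hcard hk

/-- A line under the upper envelope of two test lines meets few triangles that neither of the test
lines meets. -/
lemma crossings_le_of_le_envelope {P : Finset (ℝ × ℝ)} {k j : ℕ} (hk : 1 ≤ k)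
    {f : ℕ → Finset (ℝ × ℝ)} {T : ℕ → Fin 3 → ℝ × ℝ}
    (hf : ∀ i < j, f i ⊆ P ∧ (f i).card = k ∧ ↑(f i) ⊆ triangle (T i))
    (hdisj : ∀ i < j, ∀ i' < j, i ≠ i' → Disjoint (f i) (f i')) {l q q' : ℝ × ℝ}
    (hq : (below P q).card ≤ 3 * k) (hq' : (below P q').card ≤ 3 * k)
    (hle : ∀ i < j, ∀ z ∈ triangle (T i),
      lineAt l z.1 ≤ lineAt q z.1 ∨ lineAt l z.1 ≤ lineAt q' z.1) :
    crossings T j l ≤ crossings T j q + crossings T j q' + 6 := by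
  set B := (Finset.range j).filter fun i => f i ⊆ below P q
  set B' := (Finset.range j).filter fun i => f i ⊆ below P q'
  have hB : B.card ≤ 3 := card_parts_below_le hk (fun i hi => (hf i hi).2.1) hdisj hq
  have hB' : B'.card ≤ 3 := card_parts_below_le hk (fun i hi => (hf i hi).2.1) hdisj hq'
  have hsub : (Finset.range j).filter (fun i => Crosses l (T i)) ⊆
      ((Finset.range j).filter (fun i => Crosses q (T i)) ∪
        (Finset.range j).filter fun i => Crosses q' (T i)) ∪ (B ∪ B') := by
    intro i hi
    obtain ⟨hij, hcross⟩ := Finset.mem_filter.1 hi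
    have hij' := Finset.mem_range.1 hij
    obtain ⟨z, hz, hzl⟩ := crosses_iff.1 hcross
    have hbelow : ∀ g, ¬ Crosses g (T i) → lineAt l z.1 ≤ lineAt g z.1 → f i ⊆ below P g :=
      fun g hg hlg p hp => mem_below.2 ⟨(hf i hij').1 hp,
        below_of_not_crosses hg hz (hzl.trans_le hlg) ((hf i hij').2.2 hp)⟩
    have h := hbelow q
    have h' := hbelow q'
    simp only [Finset.mem_union, Finset.mem_filter, B, B']
    rcases hle i hij' z hz with hlq | hlq <;> tauto
  have h1 := Finset.card_le_card hsub
  have h2 := Finset.card_union_le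
    ((Finset.range j).filter (fun i => Crosses q (T i)) ∪
      (Finset.range j).filter fun i => Crosses q' (T i)) (B ∪ B')
  have h3 := Finset.card_union_le ((Finset.range j).filter fun i => Crosses q (T i))
    ((Finset.range j).filter fun i => Crosses q' (T i))
  have h4 := Finset.card_union_le B B'
  unfold crossings
  omega

/-- Matoušek's shallow partition theorem in the plane.
There is a universal constant `C > 0` such that for all `n`, all
`k ∈ {1, …, n}` with `n/k ≥ 2`, and every `n`-point set `P ⊆ ℝ²` in general
position, some `k`-partition of `P` has crossing number at most
`C · log₂(n/k)`, i.e. every `k`-shallow line crosses at most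
`C · log₂(n/k)` of its triangles. -/
theorem statement0 :
    ∃ C : ℝ, 0 < C ∧
      ∀ (n k : ℕ) (P : Finset (ℝ × ℝ)), P.card = n → GenPos2 P →
        1 ≤ k → k ≤ n → 2 ≤ (n : ℝ) / (k : ℝ) →
        ∃ (parts : Fin ((n + k - 1) / k) → Finset (ℝ × ℝ))
          (tri : Fin ((n + k - 1) / k) → Fin 3 → ℝ × ℝ),
          IsKPartition P n k parts tri ∧
            ∀ a b : ℝ, IsShallow P k a b →
              (crossCount tri a b : ℝ) ≤ C * Real.logb 2 ((n : ℝ) / (k : ℝ)) := by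
  refine ⟨48, by norm_num, fun n k P hn hP hk hkn hnk => ?_⟩
  have hk0 : (0 : ℝ) < k := by exact_mod_cast hk
  have hlog : 1 ≤ Real.logb 2 ((n : ℝ) / k) := by
    rw [Real.le_logb_iff_rpow_le (by norm_num) (by linarith)]
    simpa using hnk
  have hceil : (n + k - 1) / k ≤ n / k + 1 := by
    rw [← Nat.add_div_right n hk]
    exact Nat.div_le_div_right (by omega)
  rcases lt_or_ge (n / k) 11 with hsmall | hlarge
  · obtain ⟨parts, tri, hpart, hcross⟩ := exists_isKPartition_extending hn hk
      (fun _ => ∅) (fun _ _ => 0) 0 (Nat.zero_le _) (by simp) (by simp)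
    refine ⟨parts, tri, hpart, fun a b _ => ?_⟩
    have h : crossCount tri a b ≤ 11 := (hcross a b).trans (by simp [crossings]; omega)
    have h' : (crossCount tri a b : ℝ) ≤ 11 := by exact_mod_cast h
    linarith
  have h2k : 2 * k ≤ P.card := by
    rw [hn]
    rw [le_div_iff₀ hk0] at hnk
    exact_mod_cast hnk
  obtain ⟨Q, hQne, hQcard, hQ, M, hMP, hMcard, henv⟩ := exists_test_lines hP hk h2k
  have hdiv : n / k * k ≤ n := Nat.div_mul_le_self n k
  obtain ⟨j, hj⟩ := Nat.exists_eq_add_of_le hlarge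
  have hjM : (j + 4) * k ≤ M.card := by
    rw [hj] at hdiv
    nlinarith
  have hbelow : ∀ q ∈ Q, (below P q).card ≤ 3 * k := fun q hq => (hQ q hq).2.trans (by omega)
  obtain ⟨f, T, hf, hdisj, hweight⟩ := exists_greedy_parts Q hQne M k hk
    (fun q hq p hp => (hQ q hq).1 p (hMP hp))
    (fun q hq => (Finset.card_le_card (Finset.filter_subset_filter _ hMP)).trans (hbelow q hq))
    j hjM
  obtain ⟨parts, tri, hpart, hcross⟩ := exists_isKPartition_extending hn hk f T j (by omega)
    (fun i hi => ⟨(hf i hi).1.trans hMP, (hf i hi).2.1, (hf i hi).2.2.1⟩) hdisj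
  refine ⟨parts, tri, hpart, fun a b hshallow => ?_⟩
  obtain ⟨q, hq, q', hq', hle⟩ := henv (a, b) hshallow.2
  have hcrossings : crossings T j (a, b) ≤ crossings T j q + crossings T j q' + 6 :=
    crossings_le_of_le_envelope hk (fun i hi => ⟨(hf i hi).1.trans hMP, (hf i hi).2.1,
      (hf i hi).2.2.1⟩) hdisj (hbelow q hq) (hbelow q' hq')
      fun i hi z hz => hle z.1 (by
        obtain ⟨m, hm, m', hm', h⟩ := (hf i hi).2.2.2 z hz
        exact ⟨m, hm, m', hm', h⟩)
  have hbound : ∀ q ∈ Q, (crossings T j q : ℝ) ≤ 15 * Real.logb 2 ((n : ℝ) / k) := by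
    intro q hq
    have hMn : (M.card : ℝ) ≤ n := by
      rw [← hn]; exact_mod_cast Finset.card_le_card hMP
    have hMj : ((j : ℝ) + 4) * k ≤ M.card := by exact_mod_cast hjM
    have hpow : (2 : ℝ) ^ crossings T j q * (k : ℝ) ^ 10 ≤ Q.card * (n : ℝ) ^ 10 := by
      calc (2 : ℝ) ^ crossings T j q * (k : ℝ) ^ 10
          ≤ (∑ q ∈ Q, (2 : ℝ) ^ crossings T j q) * (M.card - j * k : ℝ) ^ 10 := by
            refine mul_le_mul ?_ (pow_le_pow_left₀ hk0.le (by linarith) _) (by positivity)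
              (Finset.sum_nonneg fun q _ => by positivity)
            exact Finset.single_le_sum (f := fun q => (2 : ℝ) ^ crossings T j q)
              (fun q _ => by positivity) hq
        _ ≤ Q.card * (M.card : ℝ) ^ 10 := hweight
        _ ≤ Q.card * (n : ℝ) ^ 10 := by gcongr
    have hQr : (Q.card : ℝ) ≤ ((n : ℝ) / k) ^ 5 := by
      have h1 : (Q.card : ℝ) ≤ 2 * (((n / k : ℕ) : ℝ) + 1) ^ 2 + 1 := by
        rw [hn] at hQcard
        exact_mod_cast hQcard
      have h2 : ((n / k : ℕ) : ℝ) ≤ (n : ℝ) / k := Nat.cast_div_le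
      generalize (n : ℝ) / k = ρ at *
      have h3 : (((n / k : ℕ) : ℝ) + 1) ^ 2 ≤ (ρ + 1) ^ 2 := by gcongr
      have h4 : (2 : ℝ) ^ 3 ≤ ρ ^ 3 := by gcongr
      nlinarith [mul_le_mul_of_nonneg_right h4 (sq_nonneg ρ)]
    have hρ : (2 : ℝ) ^ crossings T j q ≤ ((n : ℝ) / k) ^ 15 := by
      calc (2 : ℝ) ^ crossings T j q ≤ Q.card * ((n : ℝ) / k) ^ 10 := by
            rw [div_pow, ← mul_div_assoc, le_div_iff₀ (by positivity)]
            exact hpow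
        _ ≤ ((n : ℝ) / k) ^ 5 * ((n : ℝ) / k) ^ 10 := by gcongr
        _ = ((n : ℝ) / k) ^ 15 := by ring
    calc (crossings T j q : ℝ) = Real.logb 2 ((2 : ℝ) ^ crossings T j q) := by
          rw [Real.logb_pow, Real.logb_self_eq_one (by norm_num), mul_one]
      _ ≤ Real.logb 2 (((n : ℝ) / k) ^ 15) :=
          Real.logb_le_logb_of_le (by norm_num) (by positivity) hρ
      _ = 15 * Real.logb 2 ((n : ℝ) / k) := by
          rw [Real.logb_pow]; norm_num
  have htotal : crossCount tri a b ≤ crossings T j q + crossings T j q' + 18 := by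
    have := hcross a b
    omega
  have htotal' : (crossCount tri a b : ℝ) ≤ crossings T j q + crossings T j q' + 18 := by
    exact_mod_cast htotal
  linarith [hbound q hq, hbound q' hq']

end
end

section
/- There is a constant c > 0 such that for every n and every k with log₂ n ≤ k ≤ n/4 (and n/k ≥ 4), there exists a set P of n points in ℝ² in general position such that every k-partition of P has crossing number at least c·log₂(n/k)/log₂ log₂(n/k). -/
open scoped Classical

noncomputable section

/-- A nonempty open set in the plane has a point off all lines spanned by a finite set. -/
theorem exists_mem_open_notMem_lines {U : Set (ℝ × ℝ)} (hU : IsOpen U) (hne : U.Nonempty)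
    (P : Finset (ℝ × ℝ)) :
    ∃ z ∈ U, ∀ p ∈ P, ∀ q ∈ P, z ∉ line[ℝ, p, q] := by
  by_contra! h
  have hsub : U ⊆ ⋃ p ∈ P, ⋃ q ∈ P, (line[ℝ, p, q] : Set (ℝ × ℝ)) := by
    intro z hz
    obtain ⟨p, hp, q, hq, hzq⟩ := h z hz
    simp only [Set.mem_iUnion]
    exact ⟨p, hp, q, hq, hzq⟩
  have hline : ∀ p q : ℝ × ℝ,
      MeasureTheory.volume (line[ℝ, p, q] : Set (ℝ × ℝ)) = 0 := by
    intro p q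
    apply MeasureTheory.Measure.addHaar_affineSubspace
    intro htop
    have h1 : Module.finrank ℝ (vectorSpan ℝ ({p, q} : Set (ℝ × ℝ))) ≤ 1 :=
      collinear_iff_finrank_le_one.1 (collinear_pair ℝ p q)
    rw [← direction_affineSpan, htop, AffineSubspace.direction_top, finrank_top,
      Module.finrank_prod, Module.finrank_self] at h1
    omega
  have hzero : MeasureTheory.volume (⋃ p ∈ P, ⋃ q ∈ P, (line[ℝ, p, q] : Set (ℝ × ℝ))) = 0 := by
    refine (MeasureTheory.measure_biUnion_null_iff P.countable_toSet).2 fun p _ => ?_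
    exact (MeasureTheory.measure_biUnion_null_iff P.countable_toSet).2 fun q _ => hline p q
  exact (hU.measure_pos MeasureTheory.volume hne).ne' (MeasureTheory.measure_mono_null hsub hzero)

/-- A point off all lines spanned by a set in general position can be added to the set. -/
theorem GenPos2.insert {P : Finset (ℝ × ℝ)} (hP : GenPos2 P) {z : ℝ × ℝ}
    (hz : ∀ p ∈ P, ∀ q ∈ P, z ∉ line[ℝ, p, q]) : GenPos2 (insert z P) := by
  have key : ∀ a ∈ P, ∀ b ∈ P, a ≠ b → ¬ Collinear ℝ ({a, b, z} : Set (ℝ × ℝ)) :=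
    fun a ha b hb hab hc => hz a ha b hb
      (hc.mem_affineSpan_of_mem_of_ne (by simp) (by simp) (by simp) hab)
  intro p hp q hq r hr hpq hqr hpr hc
  rw [Finset.mem_insert] at hp hq hr
  rcases hp with rfl | hp
  · have hq' := hq.resolve_left hpq.symm
    have hr' := hr.resolve_left hpr.symm
    refine key q hq' r hr' hqr (hc.subset ?_)
    intro x; simp only [Set.mem_insert_iff, Set.mem_singleton_iff]; tauto
  · rcases hq with rfl | hq
    · have hr' := hr.resolve_left hqr.symm
      refine key p hp r hr' hpr (hc.subset ?_)
      intro x; simp only [Set.mem_insert_iff, Set.mem_singleton_iff]; tauto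
    · rcases hr with rfl | hr
      · exact key p hp q hq hpq hc
      · exact hP p hp q hq r hr hpq hqr hpr hc

/-- One can choose a point from each of finitely many nonempty open sets such that the chosen
points are distinct and in general position. -/
theorem exists_genPos2_mem_open {X : Type*} [Fintype X] (U : X → Set (ℝ × ℝ))
    (hU : ∀ x, IsOpen (U x)) (hne : ∀ x, (U x).Nonempty) :
    ∃ f : X → ℝ × ℝ, Function.Injective f ∧ (∀ x, f x ∈ U x) ∧
      GenPos2 (Finset.univ.image f) := by
  suffices h : ∀ S : Finset X, ∃ f : X → ℝ × ℝ, Set.InjOn f S ∧ (∀ x, f x ∈ U x) ∧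
      GenPos2 (S.image f) by
    obtain ⟨f, h1, h2, h3⟩ := h Finset.univ
    exact ⟨f, by simpa using h1, h2, h3⟩
  intro S
  induction S using Finset.induction_on with
  | empty =>
    choose f hf using hne
    exact ⟨f, by simp, hf, by simp [GenPos2]⟩
  | insert a S ha ih =>
    obtain ⟨f, hinj, hmem, hgen⟩ := ih
    obtain ⟨z, hzU, hz⟩ := exists_mem_open_notMem_lines (hU a) (hne a) (S.image f)
    have hzS : ∀ x ∈ S, z ≠ f x := by
      rintro x hx rfl
      exact hz _ (Finset.mem_image_of_mem f hx) _ (Finset.mem_image_of_mem f hx)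
        (left_mem_affineSpan_pair ℝ _ _)
    have hoff : ∀ x ∈ S, Function.update f a z x = f x := fun x hx =>
      Function.update_of_ne (ne_of_mem_of_not_mem hx ha) _ _
    refine ⟨Function.update f a z, ?_, ?_, ?_⟩
    · intro x hx y hy hxy
      simp only [Finset.coe_insert, Set.mem_insert_iff, Finset.mem_coe] at hx hy
      rcases hx with rfl | hx <;> rcases hy with rfl | hy
      · rfl
      · rw [Function.update_self, hoff y hy] at hxy
        exact absurd hxy (hzS y hy)
      · rw [Function.update_self, hoff x hx] at hxy
        exact absurd hxy.symm (hzS x hx)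
      · rw [hoff x hx, hoff y hy] at hxy
        exact hinj hx hy hxy
    · intro x
      by_cases hx : x = a
      · subst hx; simpa using hzU
      · rw [Function.update_of_ne hx]; exact hmem x
    · rw [Finset.image_insert, Function.update_self, Finset.image_congr hoff]
      exact hgen.insert hz

/-- The points lying strictly below exactly those tangents `y = 2qx - q²` of the parabola with
`q ∈ [a, a + w)`, and strictly above the tangents for all other natural `q < M`. -/
def tangentCell (M a w : ℕ) : Set (ℝ × ℝ) :=
  {z | ∀ q ∈ Finset.range M,
    if q ∈ Finset.Ico a (a + w) then z.2 < 2 * (q : ℝ) * z.1 + -(q : ℝ) ^ 2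
    else 2 * (q : ℝ) * z.1 + -(q : ℝ) ^ 2 < z.2}

theorem isOpen_tangentCell (M a w : ℕ) : IsOpen (tangentCell M a w) := by
  have h : tangentCell M a w = ⋂ q ∈ Finset.range M, {z : ℝ × ℝ |
      if q ∈ Finset.Ico a (a + w) then z.2 < 2 * (q : ℝ) * z.1 + -(q : ℝ) ^ 2
      else 2 * (q : ℝ) * z.1 + -(q : ℝ) ^ 2 < z.2} := by
    ext z; simp [tangentCell]
  rw [h]
  refine isOpen_biInter_finset fun q _ => ?_
  split_ifs
  · exact isOpen_lt (by fun_prop) (by fun_prop)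
  · exact isOpen_lt (by fun_prop) (by fun_prop)

theorem tangentCell_nonempty (M a w : ℕ) : (tangentCell M a w).Nonempty := by
  refine ⟨((a : ℝ) + ((w : ℝ) - 1) / 2, ((a : ℝ) + ((w : ℝ) - 1) / 2) ^ 2 - (w : ℝ) ^ 2 / 4), ?_⟩
  intro q _
  split_ifs with h
  · rw [Finset.mem_Ico] at h
    have h1 : (a : ℝ) ≤ q := by exact_mod_cast h.1
    have h2 : (q : ℝ) + 1 ≤ a + w := by exact_mod_cast h.2
    dsimp only
    nlinarith [mul_nonneg (sub_nonneg.2 h1) (sub_nonneg.2 h2)]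
  · have h' : (q : ℝ) + 1 ≤ a ∨ (a : ℝ) + w ≤ q := by
      rw [Finset.mem_Ico] at h
      by_cases h1 : a ≤ q
      · right; exact_mod_cast (by omega : a + w ≤ q)
      · left; exact_mod_cast (by omega : q + 1 ≤ a)
    have hw : (0 : ℝ) ≤ w := Nat.cast_nonneg w
    dsimp only
    rcases h' with h' | h'
    · nlinarith [mul_nonneg (sub_nonneg.2 h') hw, mul_self_nonneg ((a : ℝ) - (q + 1))]
    · nlinarith [mul_nonneg (sub_nonneg.2 h') hw, mul_self_nonneg ((q : ℝ) - (a + w))]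

/-- The `q < M` separating two members of `G`: contained in some `I x` with `x ∈ G`, but not in
all of them. -/
def separators {X : Type*} (I : X → Finset ℕ) (M : ℕ) (G : Finset X) : Finset ℕ :=
  (Finset.range M).filter fun q => (∃ x ∈ G, q ∈ I x) ∧ ∃ y ∈ G, q ∉ I y

/-- In a laminar family whose set sizes jump by factors of `B` and in which each point lies in at
most `t` sets of a given size, a group of at most `B * t` sets is separated by many points, unless
it consists of few copies of one set. -/
theorem sum_card_le_separators {X : Type*} (I : X → Finset ℕ) {M t B : ℕ} (hB : 2 ≤ B)
    (hM : ∀ x, I x ⊆ Finset.range M)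
    (hmult : ∀ (S : Finset X) (q l : ℕ), (∀ x ∈ S, q ∈ I x ∧ (I x).card = l) → S.card ≤ t)
    (hjump : ∀ x y, (I x).card < (I y).card → B * (I x).card ≤ (I y).card)
    (hlam : ∀ x y, (I x).card = (I y).card → I x = I y ∨ Disjoint (I x) (I y))
    (G : Finset X) (hG : G.card ≤ B * t) :
    ∑ x ∈ G, (I x).card ≤
      4 * t * (separators I M G).card + if G.card ≤ t then t * M else 0 := by
  rcases G.eq_empty_or_nonempty with rfl | hne
  · simp
  obtain ⟨x₀, hx₀, hmax⟩ := Finset.exists_max_image G (fun x => (I x).card) hne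
  rcases Nat.eq_zero_or_pos (I x₀).card with h0 | hpos
  · rw [Finset.sum_eq_zero]
    · exact Nat.zero_le _
    · intro x hx
      have := hmax x hx
      omega
  by_cases hsame : ∀ x ∈ G, I x = I x₀
  · obtain ⟨q, hq⟩ := Finset.card_pos.1 hpos
    have hGt : G.card ≤ t := hmult G q (I x₀).card fun x hx => by
      rw [hsame x hx]; exact ⟨hq, rfl⟩
    rw [if_pos hGt]
    have hle : ∀ x ∈ G, (I x).card ≤ M := fun x _ => by
      simpa using Finset.card_le_card (hM x)
    calc ∑ x ∈ G, (I x).card ≤ G.card * M := by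
          simpa using Finset.sum_le_card_nsmul G _ M hle
      _ ≤ t * M := Nat.mul_le_mul_right _ hGt
      _ ≤ _ := Nat.le_add_left _ _
  push Not at hsame
  obtain ⟨x₁, hx₁, hdiff⟩ := hsame
  set l := (I x₀).card with hl
  set T := G.filter fun x => (I x).card = l with hT
  set U := T.biUnion I with hUdef
  have hx₀U : I x₀ ⊆ U := Finset.subset_biUnion_of_mem I (by simp [hT, hx₀, hl])
  have hlU : l ≤ U.card := Finset.card_le_card hx₀U
  have htop : ∑ x ∈ T, (I x).card ≤ t * U.card := by
    have h1 : ∑ x ∈ T, (I x).card = ∑ q ∈ U, (T.filter fun x => q ∈ I x).card := by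
      have h2 := Finset.sum_card_bipartiteAbove_eq_sum_card_bipartiteBelow
        (s := T) (t := U) (fun x q => q ∈ I x)
      simp only [Finset.bipartiteAbove, Finset.bipartiteBelow] at h2
      rw [← h2]
      refine Finset.sum_congr rfl fun x hx => ?_
      congr 1
      ext q
      simp only [Finset.mem_filter]
      exact ⟨fun h => ⟨Finset.mem_biUnion.2 ⟨x, hx, h⟩, h⟩, fun h => h.2⟩
    rw [h1, mul_comm]
    simpa using Finset.sum_le_card_nsmul U _ t fun q _ => hmult _ q l fun x hx => by
      simp only [hT, Finset.mem_filter] at hx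
      exact ⟨hx.2, hx.1.2⟩
  have hrest : ∑ x ∈ G.filter (fun x => ¬ (I x).card = l), (I x).card ≤ t * U.card := by
    have h1 : B * ∑ x ∈ G.filter (fun x => ¬ (I x).card = l), (I x).card ≤ B * (t * l) := by
      rw [Finset.mul_sum]
      calc _ ≤ (G.filter (fun x => ¬ (I x).card = l)).card * l := by
            simpa using Finset.sum_le_card_nsmul _ _ l fun x hx => by
              simp only [Finset.mem_filter] at hx
              exact hjump x x₀ (lt_of_le_of_ne (hmax x hx.1) hx.2)
        _ ≤ (B * t) * l :=
            Nat.mul_le_mul_right _ ((Finset.card_le_card (Finset.filter_subset _ _)).trans hG)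
        _ = _ := by ring
    exact (Nat.le_of_mul_le_mul_left h1 (by omega)).trans (Nat.mul_le_mul_left _ hlU)
  have hsum : ∑ x ∈ G, (I x).card ≤ 2 * t * U.card := by
    have h1 := Finset.sum_filter_add_sum_filter_not G (fun x => (I x).card = l)
      fun x => (I x).card
    rw [← hT] at h1
    linarith
  have hsub : U \ (I x₀ ∩ I x₁) ⊆ separators I M G := by
    intro q hq
    rw [Finset.mem_sdiff, Finset.mem_inter] at hq
    obtain ⟨x, hx, hqx⟩ := Finset.mem_biUnion.1 hq.1
    refine Finset.mem_filter.2 ⟨hM x hqx, ⟨x, (Finset.mem_filter.1 hx).1, hqx⟩, ?_⟩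
    by_cases h : q ∈ I x₀
    · exact ⟨x₁, hx₁, fun h' => hq.2 ⟨h, h'⟩⟩
    · exact ⟨x₀, hx₀, h⟩
  have hinter : 2 * (I x₀ ∩ I x₁).card ≤ U.card := by
    rcases (hmax x₁ hx₁).lt_or_eq with hlt | heq
    · have h1 := hjump x₁ x₀ hlt
      have h2 : (I x₀ ∩ I x₁).card ≤ (I x₁).card := Finset.card_le_card Finset.inter_subset_right
      nlinarith
    · rcases hlam x₁ x₀ heq with h | h
      · exact absurd h hdiff
      · rw [Finset.inter_comm, Finset.disjoint_iff_inter_eq_empty.1 h]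
        simp
  have hcr : U.card ≤ 2 * (separators I M G).card := by
    have h1 := Finset.card_le_card hsub
    have h2 := Finset.le_card_sdiff (I x₀ ∩ I x₁) U
    omega
  calc ∑ x ∈ G, (I x).card ≤ 2 * t * U.card := hsum
    _ ≤ 2 * t * (2 * (separators I M G).card) := Nat.mul_le_mul_left _ hcr
    _ = 4 * t * (separators I M G).card := by ring
    _ ≤ _ := Nat.le_add_right _ _

/-- A line separating two points of a triangle, neither of which lies on it, meets it. -/
theorem lineSet_inter_triangle_nonempty {T : Fin 3 → ℝ × ℝ} {a b : ℝ} {p q : ℝ × ℝ}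
    (hp : p ∈ triangle T) (hq : q ∈ triangle T) (hpb : p.2 < a * p.1 + b)
    (hqb : a * q.1 + b < q.2) : (lineSet a b ∩ triangle T).Nonempty := by
  have hconn : IsPreconnected (triangle T) := (convex_convexHull ℝ _).isPreconnected
  obtain ⟨z, hz, hz0⟩ := hconn.intermediate_value hp hq
    (f := fun z : ℝ × ℝ => z.2 - (a * z.1 + b)) (by fun_prop)
    (show (0 : ℝ) ∈ Set.Icc _ _ from ⟨by linarith, by linarith⟩)
  refine ⟨z, ?_, hz⟩
  simp only [lineSet, Set.mem_ofPred_eq]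
  dsimp only at hz0
  linarith

/-- Copies of the nodes of the complete `B`-ary tree with `s` levels, each taken `t` times,
together with `r` dummies. -/
abbrev TreePoint (B s t r : ℕ) : Type :=
  ((Σ e : Fin s, Fin (B ^ (s - 1 - (e : ℕ)))) × Fin t) ⊕ Fin r

/-- The interval of leaves of the complete `B`-ary tree below a node, as its start and length. -/
def leafInterval {B s t r : ℕ} : TreePoint B s t r → ℕ × ℕ
  | .inl x => ((x.1.2 : ℕ) * B ^ (x.1.1 : ℕ), B ^ (x.1.1 : ℕ))
  | .inr _ => (0, 0)

/-- The leaves below a node, as a finite set; empty for the dummies. -/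
def leafSet {B s t r : ℕ} (x : TreePoint B s t r) : Finset ℕ :=
  Finset.Ico (leafInterval x).1 ((leafInterval x).1 + (leafInterval x).2)

section Tree

variable {B s t r : ℕ}

theorem card_leafSet (x : TreePoint B s t r) : (leafSet x).card = (leafInterval x).2 := by
  simp [leafSet]

theorem mem_leafSet_inl (hB : 2 ≤ B) {e : Fin s} {v : Fin (B ^ (s - 1 - (e : ℕ)))} {c : Fin t}
    {q : ℕ} : q ∈ leafSet (.inl (⟨e, v⟩, c) : TreePoint B s t r) ↔ q / B ^ (e : ℕ) = v := by
  have hpos : 0 < B ^ (e : ℕ) := by positivity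
  simp only [leafSet, leafInterval, Finset.mem_Ico]
  rw [Nat.div_eq_iff hpos]
  constructor
  · rintro ⟨h1, h2⟩; exact ⟨h1, by omega⟩
  · rintro ⟨h1, h2⟩; exact ⟨h1, by omega⟩

theorem notMem_leafSet_inr {i : Fin r} {q : ℕ} :
    q ∉ leafSet (.inr i : TreePoint B s t r) := by
  simp [leafSet, leafInterval]

theorem leafSet_subset_range (x : TreePoint B s t r) :
    leafSet x ⊆ Finset.range (B ^ (s - 1)) := by
  rcases x with ⟨⟨e, v⟩, c⟩ | i
  · intro q hq
    simp only [leafSet, leafInterval, Finset.mem_Ico] at hq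
    have hv : (v : ℕ) + 1 ≤ B ^ (s - 1 - (e : ℕ)) := v.2
    have he : s - 1 - (e : ℕ) + e = s - 1 := by omega
    have h := Nat.mul_le_mul_right (B ^ (e : ℕ)) hv
    rw [← pow_add, he, add_mul] at h
    rw [Finset.mem_range]
    omega
  · simp [leafSet, leafInterval]

theorem card_le_of_leafSet_level (hB : 2 ≤ B) (S : Finset (TreePoint B s t r)) (q l : ℕ)
    (hS : ∀ x ∈ S, q ∈ leafSet x ∧ (leafSet x).card = l) : S.card ≤ t := by
  rcases S.eq_empty_or_nonempty with rfl | ⟨x₀, hx₀⟩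
  · simp
  have ht : ∃ c₀ : Fin t, True := by
    rcases x₀ with ⟨_, c⟩ | i
    · exact ⟨c, trivial⟩
    · exact absurd (hS _ hx₀).1 notMem_leafSet_inr
  obtain ⟨c₀, -⟩ := ht
  have h := Finset.card_le_card_of_injOn (s := S) (t := (Finset.univ : Finset (Fin t)))
    (Sum.elim (fun y => y.2) (fun _ => c₀)) (by simp) ?_
  · simpa using h
  rintro x hx y hy hxy
  obtain ⟨hx1, hx2⟩ := hS x hx
  obtain ⟨hy1, hy2⟩ := hS y hy
  rcases x with ⟨⟨e, v⟩, c⟩ | i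
  · rcases y with ⟨⟨e', v'⟩, c'⟩ | i
    · rw [card_leafSet] at hx2 hy2
      simp only [leafInterval] at hx2 hy2
      have hee : (e : ℕ) = e' := Nat.pow_right_injective hB (hx2.trans hy2.symm)
      obtain rfl : e = e' := Fin.ext hee
      rw [mem_leafSet_inl hB] at hx1 hy1
      obtain rfl : v = v' := Fin.ext (hx1.symm.trans hy1)
      simp only [Sum.elim_inl] at hxy
      rw [hxy]
    · exact absurd hy1 notMem_leafSet_inr
  · exact absurd hx1 notMem_leafSet_inr

theorem card_leafSet_jump (hB : 2 ≤ B) (x y : TreePoint B s t r)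
    (h : (leafSet x).card < (leafSet y).card) : B * (leafSet x).card ≤ (leafSet y).card := by
  rw [card_leafSet, card_leafSet] at *
  rcases x with ⟨⟨e, v⟩, c⟩ | i
  · rcases y with ⟨⟨e', v'⟩, c'⟩ | i
    · simp only [leafInterval] at *
      have hlt : (e : ℕ) < e' := (Nat.pow_lt_pow_iff_right (by omega)).1 h
      rw [← pow_succ']
      exact Nat.pow_le_pow_right (by omega) hlt
    · simp [leafInterval] at h
  · simp [leafInterval]

theorem leafSet_laminar (hB : 2 ≤ B) (x y : TreePoint B s t r)
    (h : (leafSet x).card = (leafSet y).card) :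
    leafSet x = leafSet y ∨ Disjoint (leafSet x) (leafSet y) := by
  rcases x with ⟨⟨e, v⟩, c⟩ | i
  · rcases y with ⟨⟨e', v'⟩, c'⟩ | i
    · rw [card_leafSet, card_leafSet] at h
      simp only [leafInterval] at h
      obtain rfl : e = e' := Fin.ext (Nat.pow_right_injective hB h)
      by_cases hv : v = v'
      · left; subst hv; rfl
      · right
        rw [Finset.disjoint_left]
        intro q hq hq'
        rw [mem_leafSet_inl hB] at hq hq'
        exact hv (Fin.ext (hq.symm.trans hq'))
    · right; simp [leafSet, leafInterval]
  · right; simp [leafSet, leafInterval]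

theorem sum_card_leafSet :
    ∑ x : TreePoint B s t r, (leafSet x).card = s * t * B ^ (s - 1) := by
  simp only [card_leafSet, Fintype.sum_sum_type, leafInterval, Fintype.sum_prod_type,
    Fintype.sum_sigma, Finset.sum_const, Finset.card_univ, Fintype.card_fin, smul_eq_mul,
    mul_zero, add_zero]
  have h : ∀ e ∈ (Finset.univ : Finset (Fin s)),
      B ^ (s - 1 - (e : ℕ)) * (t * B ^ (e : ℕ)) = t * B ^ (s - 1) := by
    intro e _
    have he : s - 1 - (e : ℕ) + e = s - 1 := by omega
    calc _ = t * (B ^ (s - 1 - (e : ℕ)) * B ^ (e : ℕ)) := by ring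
      _ = _ := by rw [← pow_add, he]
  rw [Finset.sum_congr rfl h]
  simp [mul_assoc]

theorem card_filter_mem_leafSet_le (hB : 2 ≤ B) (q : ℕ) :
    ((Finset.univ : Finset (TreePoint B s t r)).filter fun x => q ∈ leafSet x).card ≤ s * t := by
  have hmaps : ∀ x ∈ (Finset.univ : Finset (TreePoint B s t r)).filter (fun x => q ∈ leafSet x),
      (leafSet x).card ∈ (Finset.range s).image fun e => B ^ e := by
    intro x hx
    rcases x with ⟨⟨e, v⟩, c⟩ | i
    · rw [card_leafSet]
      exact Finset.mem_image.2 ⟨e, Finset.mem_range.2 e.2, rfl⟩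
    · exact absurd (Finset.mem_filter.1 hx).2 notMem_leafSet_inr
  have h := Finset.card_le_mul_card_image_of_maps_to hmaps t fun l _ =>
    card_le_of_leafSet_level hB _ q l fun x hx => by
      simp only [Finset.mem_filter] at hx
      exact ⟨hx.1.2, hx.2⟩
  calc _ ≤ t * ((Finset.range s).image fun e => B ^ e).card := h
    _ ≤ t * s := Nat.mul_le_mul_left _ (Finset.card_image_le.trans (by simp))
    _ = s * t := mul_comm _ _

theorem card_treePoint :
    Fintype.card (TreePoint B s t r) = (∑ e ∈ Finset.range s, B ^ e) * t + r := by
  simp only [Fintype.card_sum, Fintype.card_prod, Fintype.card_sigma, Fintype.card_fin]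
  rw [Fin.sum_univ_eq_sum_range (fun e => B ^ (s - 1 - e)) s,
    Finset.sum_range_reflect (fun e => B ^ e) s]

end Tree

theorem sum_pow_range_le_two_mul {B s : ℕ} (hB : 2 ≤ B) (hs : 1 ≤ s) :
    ∑ e ∈ Finset.range s, B ^ e ≤ 2 * B ^ (s - 1) := by
  induction s, hs using Nat.le_induction with
  | base => simp
  | succ s hs ih =>
    rw [Finset.sum_range_succ, Nat.add_sub_cancel]
    obtain ⟨u, rfl⟩ := Nat.exists_eq_add_of_le' hs
    rw [Nat.add_sub_cancel] at ih
    rw [pow_succ']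
    nlinarith [Nat.mul_le_mul_right (B ^ u) hB]

namespace IsKPartition

variable {P : Finset (ℝ × ℝ)} {n k : ℕ} {parts : Fin ((n + k - 1) / k) → Finset (ℝ × ℝ)}
  {tri : Fin ((n + k - 1) / k) → Fin 3 → ℝ × ℝ}

theorem sum_card (h : IsKPartition P n k parts tri) : ∑ i, (parts i).card = P.card := by
  rw [← h.cover, Finset.card_biUnion fun i _ j _ hij => h.disjoint i j hij]

/-- All but at most one part have exactly `k` points. -/
theorem card_filter_card_ne_le_one (h : IsKPartition P n k parts tri) (hk : 0 < k) :
    (Finset.univ.filter fun i => (parts i).card ≠ k).card ≤ 1 := by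
  rw [Finset.card_le_one]
  have key : ∀ i : Fin ((n + k - 1) / k), (parts i).card ≠ k → (i : ℕ) = n / k := by
    intro i hi
    have h1 : ¬ (i : ℕ) < n / k := fun hlt => hi (h.size i hlt)
    have h2 : (n + k - 1) / k ≤ n / k + 1 := by
      rw [← Nat.add_div_right n hk]
      exact Nat.div_le_div_right (by omega)
    have := i.2
    omega
  intro i hi j hj
  simp only [Finset.mem_filter, Finset.mem_univ, true_and] at hi hj
  exact Fin.ext ((key i hi).trans (key j hj).symm)

theorem card_le (h : IsKPartition P n k parts tri) (hP : P.card = n) (hk : 0 < k)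
    (i : Fin ((n + k - 1) / k)) : (parts i).card ≤ k := by
  by_cases hi : (i : ℕ) < n / k
  · exact (h.size i hi).le
  have hN : n / k + 1 ≤ (n + k - 1) / k := by have := i.2; omega
  have hsplit : ∑ j ∈ Finset.univ.filter (fun j : Fin ((n + k - 1) / k) => (j : ℕ) < n / k),
      (parts j).card = n / k * k := by
    rw [Finset.sum_congr rfl fun j hj => h.size j (Finset.mem_filter.1 hj).2, Finset.sum_const,
      smul_eq_mul]
    congr 1
    rw [Fin.card_filter_val_lt]
    omega
  have hle : (parts i).card + n / k * k ≤ n := by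
    rw [← hsplit, ← Finset.sum_insert (f := fun j => (parts j).card) (by simp [hi])]
    exact (Finset.sum_le_sum_of_subset (Finset.subset_univ _)).trans (h.sum_card.trans hP).le
  have := Nat.div_add_mod n k
  have := Nat.mod_lt n hk
  rw [mul_comm] at hle
  omega

end IsKPartition

/-- The combinatorial form of the lower bound: `s` levels of a `2s`-ary tree force some shallow
line to cross `(s - 1) / 4` triangles. -/
theorem exists_crossing_ge {n k s : ℕ} (hs : 2 ≤ s) (hsk : s ≤ k)
    (hn : k * (2 * s) ^ (s - 1) ≤ n) :
    ∃ P : Finset (ℝ × ℝ), P.card = n ∧ GenPos2 P ∧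
      ∀ (parts : Fin ((n + k - 1) / k) → Finset (ℝ × ℝ))
        (tri : Fin ((n + k - 1) / k) → Fin 3 → ℝ × ℝ),
        IsKPartition P n k parts tri →
        ∃ a b : ℝ, IsShallow P k a b ∧ s ≤ 4 * crossCount tri a b + 1 := by
  obtain ⟨B, hBdef⟩ : ∃ B, B = 2 * s := ⟨_, rfl⟩
  obtain ⟨t, htdef⟩ : ∃ t, t = k / s := ⟨_, rfl⟩
  obtain ⟨M, hMdef⟩ : ∃ M, M = B ^ (s - 1) := ⟨_, rfl⟩
  have hB : 2 ≤ B := by omega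
  have hk : 0 < k := by omega
  have ht : 0 < t := htdef ▸ Nat.div_pos hsk (by omega)
  have hMpos : 0 < M := hMdef ▸ by positivity
  have hst : s * t ≤ k := htdef ▸ Nat.mul_div_le k s
  have htk : t < k := by nlinarith
  have hkB : k ≤ B * t := by
    have h1 := Nat.lt_mul_div_succ k (show 0 < s by omega)
    rw [← htdef] at h1
    have h2 : s * (t + 1) ≤ B * t := by rw [hBdef]; nlinarith
    omega
  have hcount : (∑ e ∈ Finset.range s, B ^ e) * t ≤ n := by
    calc _ ≤ 2 * B ^ (s - 1) * t :=
          Nat.mul_le_mul_right _ (sum_pow_range_le_two_mul hB (by omega))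
      _ = (2 * t) * B ^ (s - 1) := by ring
      _ ≤ k * B ^ (s - 1) := Nat.mul_le_mul_right _ (by nlinarith)
      _ ≤ n := by rw [hBdef]; exact hn
  obtain ⟨r, hr⟩ := Nat.exists_eq_add_of_le hcount
  obtain ⟨f, hinj, hcell, hgen⟩ := exists_genPos2_mem_open
    (fun x : TreePoint B s t r => tangentCell M (leafInterval x).1 (leafInterval x).2)
    (fun x => isOpen_tangentCell _ _ _) (fun x => tangentCell_nonempty _ _ _)
  have hbelow : ∀ x, ∀ q ∈ Finset.range M, q ∈ leafSet x →
      (f x).2 < 2 * (q : ℝ) * (f x).1 + -(q : ℝ) ^ 2 := fun x q hq hx => by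
    have h := hcell x q hq
    rw [leafSet] at hx
    rwa [if_pos hx] at h
  have habove : ∀ x, ∀ q ∈ Finset.range M, q ∉ leafSet x →
      2 * (q : ℝ) * (f x).1 + -(q : ℝ) ^ 2 < (f x).2 := fun x q hq hx => by
    have h := hcell x q hq
    rw [leafSet] at hx
    rwa [if_neg hx] at h
  have hcard : (Finset.univ.image f).card = n := by
    rw [Finset.card_image_of_injective _ hinj, Finset.card_univ, card_treePoint, hr]
  refine ⟨Finset.univ.image f, hcard, hgen, fun parts tri hpart => ?_⟩
  have hshallow : ∀ q ∈ Finset.range M,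
      IsShallow (Finset.univ.image f) k (2 * (q : ℝ)) (-(q : ℝ) ^ 2) := by
    intro q hq
    constructor
    · intro p hp hline
      obtain ⟨x, -, rfl⟩ := Finset.mem_image.1 hp
      simp only [lineSet, Set.mem_ofPred_eq] at hline
      by_cases hx : q ∈ leafSet x
      · exact (hbelow x q hq hx).ne hline
      · exact (habove x q hq hx).ne' hline
    · rw [Finset.filter_image]
      refine Finset.card_image_le.trans (le_trans (Finset.card_le_card ?_)
        ((card_filter_mem_leafSet_le hB q).trans hst))
      intro x hx
      refine Finset.mem_filter.2 ⟨Finset.mem_univ x, ?_⟩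
      have hlt : (f x).2 < 2 * (q : ℝ) * (f x).1 + -(q : ℝ) ^ 2 := (Finset.mem_filter.1 hx).2
      by_contra hx'
      exact hlt.not_gt (habove x q hq hx')
  let G : Fin ((n + k - 1) / k) → Finset (TreePoint B s t r) :=
    fun i => Finset.univ.filter fun x => f x ∈ parts i
  have hGcard : ∀ i, (G i).card = (parts i).card := by
    intro i
    rw [← Finset.card_image_of_injective (G i) hinj]
    congr 1
    ext p
    simp only [G, Finset.mem_image, Finset.mem_filter, Finset.mem_univ, true_and]
    constructor
    · rintro ⟨x, hx, rfl⟩; exact hx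
    · intro hp
      have : p ∈ Finset.univ.image f := by
        rw [← hpart.cover]; exact Finset.mem_biUnion.2 ⟨i, Finset.mem_univ _, hp⟩
      obtain ⟨x, -, rfl⟩ := Finset.mem_image.1 this
      exact ⟨x, hp, rfl⟩
  have hGsum : ∑ i, ∑ x ∈ G i, (leafSet x).card = s * t * M := by
    rw [hMdef, ← sum_card_leafSet (r := r), ← Finset.sum_biUnion]
    · congr 1
      ext x
      have : f x ∈ Finset.univ.biUnion parts := by
        rw [hpart.cover]; exact Finset.mem_image_of_mem f (Finset.mem_univ x)
      simpa [G] using this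
    · intro i _ j _ hij
      refine Finset.disjoint_left.2 fun x hx hx' => ?_
      exact Finset.disjoint_left.1 (hpart.disjoint i j hij)
        (Finset.mem_filter.1 hx).2 (Finset.mem_filter.1 hx').2
  have hGle : ∀ i ∈ Finset.univ, ∑ x ∈ G i, (leafSet x).card ≤
      4 * t * (separators leafSet M (G i)).card + if (parts i).card ≠ k then t * M else 0 := by
    intro i _
    refine (sum_card_le_separators leafSet hB (hMdef ▸ leafSet_subset_range)
      (card_le_of_leafSet_level hB) (card_leafSet_jump hB) (leafSet_laminar hB) (G i)
      ((hGcard i).trans_le ((hpart.card_le hcard hk i).trans hkB))).trans ?_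
    refine Nat.add_le_add_left ?_ _
    rw [hGcard]
    split_ifs <;> omega
  have hsmall : ∑ i, (if (parts i).card ≠ k then t * M else 0) ≤ t * M := by
    rw [← Finset.sum_filter, Finset.sum_const, smul_eq_mul]
    simpa using Nat.mul_le_mul_right (t * M) (hpart.card_filter_card_ne_le_one hk)
  have hcross : ∑ i, (separators leafSet M (G i)).card ≤
      ∑ q ∈ Finset.range M, crossCount tri (2 * (q : ℝ)) (-(q : ℝ) ^ 2) := by
    have h2 := Finset.sum_card_bipartiteAbove_eq_sum_card_bipartiteBelow
      (s := (Finset.univ : Finset (Fin ((n + k - 1) / k)))) (t := Finset.range M)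
      (fun i q => (∃ x ∈ G i, q ∈ leafSet x) ∧ ∃ y ∈ G i, q ∉ leafSet y)
    refine (Eq.trans_le ?_ h2.le).trans (Finset.sum_le_sum fun q hq => Finset.card_le_card ?_)
    · rfl
    · intro i hi
      simp only [Finset.bipartiteBelow, Finset.mem_filter, Finset.mem_univ, true_and, G] at hi ⊢
      obtain ⟨⟨x, hx, hqx⟩, y, hy, hqy⟩ := hi
      exact lineSet_inter_triangle_nonempty (hpart.inTriangle i hx) (hpart.inTriangle i hy)
        (hbelow x q hq hqx) (habove y q hq hqy)
  by_contra! hcon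
  have hlt : ∑ q ∈ Finset.range M, (4 * crossCount tri (2 * (q : ℝ)) (-(q : ℝ) ^ 2) + 1) <
      M * s := by
    have := Finset.sum_lt_sum_of_nonempty (s := Finset.range M)
      (Finset.nonempty_range_iff.2 hMpos.ne') fun q hq => hcon _ _ (hshallow q hq)
    simpa using this
  have htotal := Finset.sum_le_sum hGle
  rw [hGsum, Finset.sum_add_distrib, ← Finset.mul_sum] at htotal
  rw [Finset.sum_add_distrib, ← Finset.mul_sum] at hlt
  simp only [Finset.sum_const, Finset.card_range, smul_eq_mul, mul_one] at hlt
  have h3 := Nat.mul_le_mul_left (4 * t) hcross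
  have h4 := Nat.mul_lt_mul_of_pos_left hlt ht
  nlinarith

/-- The largest depth of a `2s`-ary tree with at most `n / k` leaves. -/
theorem exists_max_depth {n k : ℕ} (hk : 0 < k) (hkn : 4 * k ≤ n) :
    ∃ s, 2 ≤ s ∧ k * (2 * s) ^ (s - 1) ≤ n ∧ n < k * (2 * s + 2) ^ s := by
  by_contra! h
  have hall : ∀ s, 2 ≤ s → k * (2 * s) ^ (s - 1) ≤ n := by
    intro s hs
    induction s, hs using Nat.le_induction with
    | base => norm_num; omega
    | succ s hs ih => simpa [mul_add] using h s hs ih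
  have h1 := hall (n + 2) (by omega)
  have h2 : n + 1 < 2 ^ (n + 1) := Nat.lt_two_pow_self
  have h3 : 2 ^ (n + 1) ≤ (2 * (n + 2)) ^ (n + 1) := Nat.pow_le_pow_left (by omega) _
  have h4 := Nat.le_mul_of_pos_left ((2 * (n + 2)) ^ (n + 1)) hk
  have h5 : n + 2 - 1 = n + 1 := rfl
  rw [h5] at h1
  omega

theorem depth_le_logb {m : ℝ} {s : ℕ} (hm : 4 ≤ m) (hs : 2 ≤ s)
    (h : (2 * (s : ℝ)) ^ (s - 1) ≤ m) : (s : ℝ) ≤ Real.logb 2 m := by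
  rw [Real.le_logb_iff_rpow_le (by norm_num) (by linarith), Real.rpow_natCast]
  refine le_trans ?_ h
  have hs' : (2 : ℝ) ≤ s := by exact_mod_cast hs
  calc (2 : ℝ) ^ s ≤ 2 ^ (2 * (s - 1)) := pow_le_pow_right₀ (by norm_num) (by omega)
    _ = 4 ^ (s - 1) := by rw [pow_mul]; norm_num
    _ ≤ _ := pow_le_pow_left₀ (by norm_num) (by linarith) _

theorem logb_div_logb_logb_le_depth {m : ℝ} {s : ℕ} (hm : 4 ≤ m)
    (hsL : (s : ℝ) ≤ Real.logb 2 m) (h : m ≤ (2 * (s : ℝ) + 2) ^ s) :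
    Real.logb 2 m / Real.logb 2 (Real.logb 2 m) ≤ 3 * s := by
  have hL : 2 ≤ Real.logb 2 m := by
    rw [Real.le_logb_iff_rpow_le (by norm_num) (by linarith)]
    norm_num; exact hm
  set L := Real.logb 2 m with hLdef
  have hLL : 1 ≤ Real.logb 2 L := by
    rw [Real.le_logb_iff_rpow_le (by norm_num) (by linarith)]
    simpa using hL
  have hs0 : (0 : ℝ) ≤ s := Nat.cast_nonneg s
  have h1 : L ≤ s * Real.logb 2 (2 * (s : ℝ) + 2) := by
    rw [← Real.logb_pow]
    exact Real.logb_le_logb_of_le (by norm_num) (by linarith) h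
  have h2 : Real.logb 2 (2 * (s : ℝ) + 2) ≤ 3 * Real.logb 2 L := by
    have h3 : Real.logb 2 (L ^ 3) = 3 * Real.logb 2 L := by rw [Real.logb_pow]; norm_num
    rw [← h3]
    refine Real.logb_le_logb_of_le (by norm_num) (by linarith) ?_
    have : 4 * L ≤ L ^ 3 := by nlinarith [mul_nonneg (by linarith : 0 ≤ L) (by nlinarith : 0 ≤ L ^ 2 - 4)]
    linarith
  rw [div_le_iff₀ (by linarith)]
  nlinarith [mul_le_mul_of_nonneg_left h2 hs0]

/-- There are arbitrarily large finite sets in general position above the `x`-axis. -/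
theorem exists_genPos2_above_axis (n : ℕ) :
    ∃ P : Finset (ℝ × ℝ), P.card = n ∧ GenPos2 P ∧ ∀ p ∈ P, 0 < p.2 := by
  obtain ⟨f, hinj, hmem, hgen⟩ := exists_genPos2_mem_open
    (fun _ : Fin n => {z : ℝ × ℝ | 0 < z.2})
    (fun _ => isOpen_lt (by fun_prop) (by fun_prop)) (fun _ => ⟨(0, 1), by simp⟩)
  refine ⟨Finset.univ.image f, by simp [Finset.card_image_of_injective _ hinj], hgen, ?_⟩
  intro p hp
  obtain ⟨x, -, rfl⟩ := Finset.mem_image.1 hp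
  exact hmem x

/-- lower bound for shallow partitions in the plane.
There is a constant `c > 0` such that for every `n` and every `k` with
`log₂ n ≤ k ≤ n/4`, there exists an `n`-point set `P ⊆ ℝ²` in general
position such that every `k`-partition of `P` has crossing number at least
`c · log₂(n/k) / log₂ log₂ (n/k)` : some `k`-shallow line crosses at least
that many of its triangles. -/
theorem statement1 :
    ∃ c : ℝ, 0 < c ∧
      ∀ n k : ℕ, Real.logb 2 (n : ℝ) ≤ (k : ℝ) → 4 * k ≤ n →
        ∃ P : Finset (ℝ × ℝ), P.card = n ∧ GenPos2 P ∧
          ∀ (parts : Fin ((n + k - 1) / k) → Finset (ℝ × ℝ))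
            (tri : Fin ((n + k - 1) / k) → Fin 3 → ℝ × ℝ),
            IsKPartition P n k parts tri →
            ∃ a b : ℝ, IsShallow P k a b ∧
              c * Real.logb 2 ((n : ℝ) / (k : ℝ)) /
                  Real.logb 2 (Real.logb 2 ((n : ℝ) / (k : ℝ))) ≤
                (crossCount tri a b : ℝ) := by
  refine ⟨1 / 24, by norm_num, fun n k hlog hkn => ?_⟩
  rcases Nat.eq_zero_or_pos k with rfl | hk
  · obtain ⟨P, hcard, hgen, hpos⟩ := exists_genPos2_above_axis n
    refine ⟨P, hcard, hgen, fun parts tri _ => ⟨0, 0, ⟨?_, ?_⟩, by simp⟩⟩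
    · intro p hp h
      have h1 : p.2 = 0 * p.1 + 0 := h
      linarith [hpos p hp]
    · rw [Nat.le_zero, Finset.card_eq_zero, Finset.filter_eq_empty_iff]
      intro p hp h
      have h1 : p.2 < 0 * p.1 + 0 := h
      linarith [hpos p hp]
  obtain ⟨s, hs, hlow, hhigh⟩ := exists_max_depth hk hkn
  have hkR : (0 : ℝ) < k := by exact_mod_cast hk
  have hm : (4 : ℝ) ≤ (n : ℝ) / k := by
    rw [le_div_iff₀ hkR]; exact_mod_cast hkn
  have hlow' : (2 * (s : ℝ)) ^ (s - 1) ≤ (n : ℝ) / k := by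
    rw [le_div_iff₀ hkR, mul_comm]; exact_mod_cast hlow
  have hhigh' : (n : ℝ) / k ≤ (2 * (s : ℝ) + 2) ^ s := by
    rw [div_le_iff₀ hkR, mul_comm]; exact_mod_cast hhigh.le
  have hsL := depth_le_logb hm hs hlow'
  have hsk : s ≤ k := by
    have h1 : Real.logb 2 ((n : ℝ) / k) ≤ Real.logb 2 n :=
      Real.logb_le_logb_of_le (by norm_num) (by linarith)
        (div_le_self (Nat.cast_nonneg n) (by exact_mod_cast hk))
    exact_mod_cast hsL.trans (h1.trans hlog)
  obtain ⟨P, hcard, hgen, hP⟩ := exists_crossing_ge hs hsk hlow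
  refine ⟨P, hcard, hgen, fun parts tri hpart => ?_⟩
  obtain ⟨a, b, hab, hcr⟩ := hP parts tri hpart
  refine ⟨a, b, hab, ?_⟩
  have h1 := logb_div_logb_logb_le_depth hm hsL hhigh'
  have h2 : (s : ℝ) ≤ 4 * (crossCount tri a b : ℝ) + 1 := by exact_mod_cast hcr
  have h3 : (2 : ℝ) ≤ s := by exact_mod_cast hs
  rw [mul_div_assoc]
  linarith

end
end

section
/- There is a constant c > 0 such that for every n and every k with log₂ n ≤ k ≤ n/4 (and n/k ≥ 4), there exists a set P of n points in ℝ³ in general position such that every k-partition of P (into parts contained in simplices) has crossing number, with respect to k-shallow planes, at least c·log₂(n/k)/log₂ log₂(n/k). -/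
open scoped Classical

noncomputable section

/-- A point set in `ℝ³` is in general position if no four distinct points are
coplanar. -/
def GenPos3 (P : Finset (ℝ × ℝ × ℝ)) : Prop :=
  ∀ p ∈ P, ∀ q ∈ P, ∀ r ∈ P, ∀ s ∈ P,
    p ≠ q → p ≠ r → p ≠ s → q ≠ r → q ≠ s → r ≠ s →
    ¬ Coplanar ℝ ({p, q, r, s} : Set (ℝ × ℝ × ℝ))

/-- The simplex (convex hull) spanned by four points of `ℝ³`. -/
def simplex3 (t : Fin 4 → ℝ × ℝ × ℝ) : Set (ℝ × ℝ × ℝ) :=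
  convexHull ℝ {t 0, t 1, t 2, t 3}

/-- The non-vertical plane `z = a*x + b*y + c`, as a set of points
`(x, y, z) ∈ ℝ³`. -/
def planeSet3 (a b c : ℝ) : Set (ℝ × ℝ × ℝ) :=
  {p | p.2.2 = a * p.1 + b * p.2.1 + c}

/-- The open halfspace strictly below the plane `z = a*x + b*y + c`. -/
def belowSet3 (a b c : ℝ) : Set (ℝ × ℝ × ℝ) :=
  {p | p.2.2 < a * p.1 + b * p.2.1 + c}

/-- A `k`-partition of an `n`-point set `P ⊆ ℝ³`: pairwise disjoint parts
`P_1, …, P_⌈n/k⌉` covering `P`, the first `⌊n/k⌋` of size exactly `k`,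
together with simplices containing the parts. -/
structure IsKPartition3 (P : Finset (ℝ × ℝ × ℝ)) (n k : ℕ)
    (parts : Fin ((n + k - 1) / k) → Finset (ℝ × ℝ × ℝ))
    (tri : Fin ((n + k - 1) / k) → Fin 4 → ℝ × ℝ × ℝ) : Prop where
  disjoint : ∀ i j, i ≠ j → Disjoint (parts i) (parts j)
  cover : Finset.univ.biUnion parts = P
  size : ∀ i : Fin ((n + k - 1) / k), (i : ℕ) < n / k → (parts i).card = k
  inSimplex : ∀ i, ↑(parts i) ⊆ simplex3 (tri i)

/-- The plane `z = a*x + b*y + c` is `k`-shallow for `P`: it contains no point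
of `P` and at most `k` points of `P` lie strictly below it. -/
def IsShallow3 (P : Finset (ℝ × ℝ × ℝ)) (k : ℕ) (a b c : ℝ) : Prop :=
  (∀ p ∈ P, p ∉ planeSet3 a b c) ∧
    (P.filter (fun p => p ∈ belowSet3 a b c)).card ≤ k

/-- The number of simplices of the partition that the plane
`z = a*x + b*y + c` intersects. -/
def crossCount3 {N : ℕ} (tri : Fin N → Fin 4 → ℝ × ℝ × ℝ) (a b c : ℝ) : ℕ :=
  (Finset.univ.filter fun i => (planeSet3 a b c ∩ simplex3 (tri i)).Nonempty).card

open Filter Topology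

theorem eventually_cubic_ne_zero {a : ℝ} (ha : a ≠ 0) (b c d : ℝ) :
    ∀ᶠ ε in 𝓝[>] (0 : ℝ), a * ε ^ 3 + b * ε ^ 2 + c * ε + d ≠ 0 := by
  set P : Cubic ℝ := ⟨a, b, c, d⟩
  have hP : P.toPoly ≠ 0 := Cubic.ne_zero_of_a_ne_zero ha
  have hfin : {x : ℝ | P.toPoly.IsRoot x}.Finite := Polynomial.finite_setOfPred_isRoot hP
  filter_upwards [hfin.eventually_cofinite_notMem.filter_mono
    ((nhdsGT_le_nhdsNE 0).trans (nhdsNE_le_cofinite 0))] with ε hε h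
  exact hε (by simpa [Polynomial.IsRoot, Cubic.toPoly, P] using h)

/-- The determinant of the three difference vectors based at `p`. -/
def det3 (p q r s : ℝ × ℝ × ℝ) : ℝ :=
  (q.1 - p.1) * ((r.2.1 - p.2.1) * (s.2.2 - p.2.2) - (r.2.2 - p.2.2) * (s.2.1 - p.2.1))
    - (q.2.1 - p.2.1) * ((r.1 - p.1) * (s.2.2 - p.2.2) - (r.2.2 - p.2.2) * (s.1 - p.1))
    + (q.2.2 - p.2.2) * ((r.1 - p.1) * (s.2.1 - p.2.1) - (r.2.1 - p.2.1) * (s.1 - p.1))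

theorem not_coplanar_of_det3_ne_zero {p q r s : ℝ × ℝ × ℝ} (h : det3 p q r s ≠ 0) :
    ¬ Coplanar ℝ ({p, q, r, s} : Set (ℝ × ℝ × ℝ)) := by
  intro hc
  have hli : LinearIndependent ℝ ![q - p, r - p, s - p] := by
    rw [Fintype.linearIndependent_iff]
    intro g hg
    simp only [Fin.sum_univ_three, Matrix.cons_val_zero, Matrix.cons_val_one,
      Matrix.cons_val, Prod.ext_iff] at hg
    simp at hg
    obtain ⟨h1, h2, h3⟩ := hg
    have h0 : g 0 * det3 p q r s = 0 := by
      unfold det3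
      linear_combination
        ((r.2.1 - p.2.1) * (s.2.2 - p.2.2) - (r.2.2 - p.2.2) * (s.2.1 - p.2.1)) * h1
        - ((r.1 - p.1) * (s.2.2 - p.2.2) - (r.2.2 - p.2.2) * (s.1 - p.1)) * h2
        + ((r.1 - p.1) * (s.2.1 - p.2.1) - (r.2.1 - p.2.1) * (s.1 - p.1)) * h3
    have h1' : g 1 * det3 p q r s = 0 := by
      unfold det3
      linear_combination
        -((q.2.1 - p.2.1) * (s.2.2 - p.2.2) - (q.2.2 - p.2.2) * (s.2.1 - p.2.1)) * h1
        + ((q.1 - p.1) * (s.2.2 - p.2.2) - (q.2.2 - p.2.2) * (s.1 - p.1)) * h2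
        - ((q.1 - p.1) * (s.2.1 - p.2.1) - (q.2.1 - p.2.1) * (s.1 - p.1)) * h3
    have h2' : g 2 * det3 p q r s = 0 := by
      unfold det3
      linear_combination
        ((q.2.1 - p.2.1) * (r.2.2 - p.2.2) - (q.2.2 - p.2.2) * (r.2.1 - p.2.1)) * h1
        - ((q.1 - p.1) * (r.2.2 - p.2.2) - (q.2.2 - p.2.2) * (r.1 - p.1)) * h2
        + ((q.1 - p.1) * (r.2.1 - p.2.1) - (q.2.1 - p.2.1) * (r.1 - p.1)) * h3
    intro i
    fin_cases i
    · exact (mul_eq_zero.1 h0).resolve_right h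
    · exact (mul_eq_zero.1 h1').resolve_right h
    · exact (mul_eq_zero.1 h2').resolve_right h
  have hle : Submodule.span ℝ (Set.range ![q - p, r - p, s - p]) ≤
      vectorSpan ℝ ({p, q, r, s} : Set (ℝ × ℝ × ℝ)) := by
    rw [Submodule.span_le]
    rintro _ ⟨i, rfl⟩
    fin_cases i <;> exact vsub_mem_vectorSpan ℝ (by simp) (by simp)
  have h3 := finrank_span_eq_card hli
  have := Submodule.finrank_mono hle
  have := hc.finrank_le_two
  simp at h3
  omega

/-- Translation of `q` along a point of the moment curve scaled by `ε`. -/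
def momentShift (q : ℝ × ℝ × ℝ) (t ε : ℝ) : ℝ × ℝ × ℝ :=
  (q.1 + ε * t, q.2.1 + ε * t ^ 2, q.2.2 + ε * t ^ 3)

theorem det_add_mul_eq_cubic (x₁ x₂ x₃ y₁ y₂ y₃ z₁ z₂ z₃ u₁ u₂ u₃ v₁ v₂ v₃ w₁ w₂ w₃ : ℝ) :
    ∃ b c d : ℝ, ∀ ε : ℝ,
      (x₁ + ε * u₁) * ((y₂ + ε * v₂) * (z₃ + ε * w₃) - (y₃ + ε * v₃) * (z₂ + ε * w₂))
        - (x₂ + ε * u₂) * ((y₁ + ε * v₁) * (z₃ + ε * w₃) - (y₃ + ε * v₃) * (z₁ + ε * w₁))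
        + (x₃ + ε * u₃) * ((y₁ + ε * v₁) * (z₂ + ε * w₂) - (y₂ + ε * v₂) * (z₁ + ε * w₁)) =
      (u₁ * (v₂ * w₃ - v₃ * w₂) - u₂ * (v₁ * w₃ - v₃ * w₁) + u₃ * (v₁ * w₂ - v₂ * w₁)) * ε ^ 3
        + b * ε ^ 2 + c * ε + d :=
  ⟨x₁ * (v₂ * w₃ - v₃ * w₂) - x₂ * (v₁ * w₃ - v₃ * w₁) + x₃ * (v₁ * w₂ - v₂ * w₁)
      + u₁ * (y₂ * w₃ - y₃ * w₂) - u₂ * (y₁ * w₃ - y₃ * w₁) + u₃ * (y₁ * w₂ - y₂ * w₁)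
      + u₁ * (v₂ * z₃ - v₃ * z₂) - u₂ * (v₁ * z₃ - v₃ * z₁) + u₃ * (v₁ * z₂ - v₂ * z₁),
    u₁ * (y₂ * z₃ - y₃ * z₂) - u₂ * (y₁ * z₃ - y₃ * z₁) + u₃ * (y₁ * z₂ - y₂ * z₁)
      + x₁ * (v₂ * z₃ - v₃ * z₂) - x₂ * (v₁ * z₃ - v₃ * z₁) + x₃ * (v₁ * z₂ - v₂ * z₁)
      + x₁ * (y₂ * w₃ - y₃ * w₂) - x₂ * (y₁ * w₃ - y₃ * w₁) + x₃ * (y₁ * w₂ - y₂ * w₁),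
    x₁ * (y₂ * z₃ - y₃ * z₂) - x₂ * (y₁ * z₃ - y₃ * z₁) + x₃ * (y₁ * z₂ - y₂ * z₁),
    fun ε => by ring⟩

theorem eventually_det3_momentShift_ne_zero (p q r s : ℝ × ℝ × ℝ) {t₁ t₂ t₃ t₄ : ℝ}
    (h₁₂ : t₁ ≠ t₂) (h₁₃ : t₁ ≠ t₃) (h₁₄ : t₁ ≠ t₄) (h₂₃ : t₂ ≠ t₃) (h₂₄ : t₂ ≠ t₄)
    (h₃₄ : t₃ ≠ t₄) :
    ∀ᶠ ε in 𝓝[>] (0 : ℝ), det3 (momentShift p t₁ ε) (momentShift q t₂ ε)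
      (momentShift r t₃ ε) (momentShift s t₄ ε) ≠ 0 := by
  obtain ⟨b, c, d, hbcd⟩ := det_add_mul_eq_cubic
    (q.1 - p.1) (q.2.1 - p.2.1) (q.2.2 - p.2.2) (r.1 - p.1) (r.2.1 - p.2.1) (r.2.2 - p.2.2)
    (s.1 - p.1) (s.2.1 - p.2.1) (s.2.2 - p.2.2)
    (t₂ - t₁) (t₂ ^ 2 - t₁ ^ 2) (t₂ ^ 3 - t₁ ^ 3) (t₃ - t₁) (t₃ ^ 2 - t₁ ^ 2) (t₃ ^ 3 - t₁ ^ 3)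
    (t₄ - t₁) (t₄ ^ 2 - t₁ ^ 2) (t₄ ^ 3 - t₁ ^ 3)
  have hV : (t₂ - t₁) * ((t₃ ^ 2 - t₁ ^ 2) * (t₄ ^ 3 - t₁ ^ 3)
        - (t₃ ^ 3 - t₁ ^ 3) * (t₄ ^ 2 - t₁ ^ 2))
      - (t₂ ^ 2 - t₁ ^ 2) * ((t₃ - t₁) * (t₄ ^ 3 - t₁ ^ 3) - (t₃ ^ 3 - t₁ ^ 3) * (t₄ - t₁))
      + (t₂ ^ 3 - t₁ ^ 3) * ((t₃ - t₁) * (t₄ ^ 2 - t₁ ^ 2) - (t₃ ^ 2 - t₁ ^ 2) * (t₄ - t₁))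
      ≠ 0 := by
    have : (t₂ - t₁) * (t₃ - t₁) * (t₄ - t₁) * (t₃ - t₂) * (t₄ - t₂) * (t₄ - t₃) ≠ 0 := by
      simp [sub_eq_zero, h₁₂.symm, h₁₃.symm, h₁₄.symm, h₂₃.symm, h₂₄.symm, h₃₄.symm]
    convert this using 1
    ring
  filter_upwards [eventually_cubic_ne_zero hV b c d] with ε hε h
  apply hε
  rw [← hbcd, ← h]
  simp only [det3, momentShift]
  ring

theorem eventually_momentShift_ne (p q : ℝ × ℝ × ℝ) {t₁ t₂ : ℝ} (h : t₁ ≠ t₂) :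
    ∀ᶠ ε in 𝓝[>] (0 : ℝ), momentShift p t₁ ε ≠ momentShift q t₂ ε := by
  filter_upwards [(Set.finite_singleton
    ((q.1 - p.1) / (t₁ - t₂))).eventually_cofinite_notMem.filter_mono
    ((nhdsGT_le_nhdsNE 0).trans (nhdsNE_le_cofinite 0))] with ε hε he
  apply hε
  have h1 := congrArg Prod.fst he
  simp only [momentShift] at h1
  rw [Set.mem_singleton_iff, eq_div_iff (sub_ne_zero.2 h)]
  linarith

theorem eventually_momentShift_side (q : ℝ × ℝ × ℝ) (t a b c : ℝ) (h : q ∉ planeSet3 a b c) :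
    ∀ᶠ ε in 𝓝[>] (0 : ℝ), momentShift q t ε ∉ planeSet3 a b c ∧
      (momentShift q t ε ∈ belowSet3 a b c ↔ q ∈ belowSet3 a b c) := by
  have hcont : Continuous fun ε : ℝ =>
      a * (momentShift q t ε).1 + b * (momentShift q t ε).2.1 + c - (momentShift q t ε).2.2 := by
    unfold momentShift
    fun_prop
  have hlim := (hcont.tendsto 0).mono_left (nhdsWithin_le_nhds (s := Set.Ioi 0))
  simp only [planeSet3, belowSet3, Set.mem_ofPred_eq] at *
  rcases lt_or_gt_of_ne h with h | h
  · have hpos : 0 < a * (momentShift q t 0).1 + b * (momentShift q t 0).2.1 + c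
        - (momentShift q t 0).2.2 := by simp only [momentShift]; linarith
    filter_upwards [hlim.eventually (lt_mem_nhds hpos)] with ε hε
    exact ⟨by intro h'; linarith, ⟨fun _ => h, fun _ => by linarith⟩⟩
  · have hneg : a * (momentShift q t 0).1 + b * (momentShift q t 0).2.1 + c
        - (momentShift q t 0).2.2 < 0 := by simp only [momentShift]; linarith
    filter_upwards [hlim.eventually (gt_mem_nhds hneg)] with ε hε
    exact ⟨by intro h'; linarith, ⟨fun _ => by linarith, fun _ => by linarith⟩⟩

/-- Finitely many points can be put in general position without changing the side on which
they lie of any of finitely many prescribed planes. -/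
theorem exists_genPos3_sameSide {ι κ : Type*} (S : Finset ι) (e : ι → ℝ)
    (he : Function.Injective e) (q : ι → ℝ × ℝ × ℝ) (U : Finset κ) (a b c : κ → ℝ)
    (h : ∀ i ∈ S, ∀ u ∈ U, q i ∉ planeSet3 (a u) (b u) (c u)) :
    ∃ p : ι → ℝ × ℝ × ℝ, Set.InjOn p S ∧ GenPos3 (S.image p) ∧
      ∀ i ∈ S, ∀ u ∈ U, p i ∉ planeSet3 (a u) (b u) (c u) ∧
        (p i ∈ belowSet3 (a u) (b u) (c u) ↔ q i ∈ belowSet3 (a u) (b u) (c u)) := by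
  have h1 : ∀ᶠ ε in 𝓝[>] (0 : ℝ), ∀ i ∈ S, ∀ j ∈ S, i ≠ j →
      momentShift (q i) (e i) ε ≠ momentShift (q j) (e j) ε := by
    simp only [eventually_all_finset, eventually_imp_distrib_left]
    exact fun i _ j _ hij => eventually_momentShift_ne _ _ (he.ne hij)
  have h2 : ∀ᶠ ε in 𝓝[>] (0 : ℝ), ∀ i ∈ S, ∀ j ∈ S, ∀ k ∈ S, ∀ l ∈ S,
      i ≠ j → i ≠ k → i ≠ l → j ≠ k → j ≠ l → k ≠ l →
      det3 (momentShift (q i) (e i) ε) (momentShift (q j) (e j) ε)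
        (momentShift (q k) (e k) ε) (momentShift (q l) (e l) ε) ≠ 0 := by
    simp only [eventually_all_finset, eventually_imp_distrib_left]
    exact fun i _ j _ k _ l _ hij hik hil hjk hjl hkl =>
      eventually_det3_momentShift_ne_zero _ _ _ _ (he.ne hij) (he.ne hik) (he.ne hil)
        (he.ne hjk) (he.ne hjl) (he.ne hkl)
  have h3 : ∀ᶠ ε in 𝓝[>] (0 : ℝ), ∀ i ∈ S, ∀ u ∈ U,
      momentShift (q i) (e i) ε ∉ planeSet3 (a u) (b u) (c u) ∧
        (momentShift (q i) (e i) ε ∈ belowSet3 (a u) (b u) (c u) ↔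
          q i ∈ belowSet3 (a u) (b u) (c u)) := by
    simp only [eventually_all_finset]
    exact fun i hi u hu => eventually_momentShift_side _ _ _ _ _ (h i hi u hu)
  obtain ⟨ε, h1, h2, h3⟩ := (h1.and (h2.and h3)).exists
  refine ⟨fun i => momentShift (q i) (e i) ε, ?_, ?_, h3⟩
  · intro i hi j hj hij
    by_contra hne
    exact h1 i hi j hj hne hij
  · intro p hp q hq r hr s hs hpq hpr hps hqr hqs hrs
    simp only [Finset.mem_image] at hp hq hr hs
    obtain ⟨i, hi, rfl⟩ := hp
    obtain ⟨j, hj, rfl⟩ := hq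
    obtain ⟨k, hk, rfl⟩ := hr
    obtain ⟨l, hl, rfl⟩ := hs
    refine not_coplanar_of_det3_ne_zero (h2 i hi j hj k hk l hl ?_ ?_ ?_ ?_ ?_ ?_) <;>
      rintro rfl <;> contradiction

/-- Planes of the form `z = u x + u² y` cut out, on suitable points, prescribed intervals of the
parameter `u`. -/
theorem exists_genPos3_interval {ι : Type*} (S : Finset ι) (e : ι → ℝ)
    (he : Function.Injective e) (m r : ι → ℝ) (U : Finset ℕ)
    (h : ∀ i ∈ S, ∀ u ∈ U, ((u : ℝ) - m i) ^ 2 ≠ r i) :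
    ∃ p : ι → ℝ × ℝ × ℝ, Set.InjOn p S ∧ GenPos3 (S.image p) ∧
      ∀ i ∈ S, ∀ u ∈ U, p i ∉ planeSet3 u (u ^ 2) 0 ∧
        (p i ∈ belowSet3 u (u ^ 2) 0 ↔ ((u : ℝ) - m i) ^ 2 < r i) := by
  obtain ⟨p, hinj, hgen, hp⟩ := exists_genPos3_sameSide S e he
    (fun i => (2 * m i, -1, m i ^ 2 - r i)) U (fun u => (u : ℝ)) (fun u => (u : ℝ) ^ 2)
    (fun _ => 0) (by
      intro i hi u hu h'
      apply h i hi u hu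
      simp only [planeSet3, Set.mem_ofPred_eq] at h'
      linarith)
  refine ⟨p, hinj, hgen, fun i hi u hu => ⟨(hp i hi u hu).1, (hp i hi u hu).2.trans ?_⟩⟩
  simp only [belowSet3, Set.mem_ofPred_eq]
  constructor <;> intro h' <;> linarith

theorem planeSet3_inter_simplex3_nonempty {t : Fin 4 → ℝ × ℝ × ℝ} {a b c : ℝ}
    {p q : ℝ × ℝ × ℝ} (hp : p ∈ simplex3 t) (hq : q ∈ simplex3 t)
    (hpb : p ∈ belowSet3 a b c) (hqb : q ∉ belowSet3 a b c) :
    (planeSet3 a b c ∩ simplex3 t).Nonempty := by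
  have hpre : IsPreconnected (simplex3 t) := (convex_convexHull ℝ _).isPreconnected
  have hcont : ContinuousOn (fun x : ℝ × ℝ × ℝ => a * x.1 + b * x.2.1 + c - x.2.2)
      (simplex3 t) := by fun_prop
  simp only [belowSet3, Set.mem_ofPred_eq, not_lt] at hpb hqb
  obtain ⟨x, hx, hx0⟩ := hpre.intermediate_value hq hp hcont
    (show (0 : ℝ) ∈ Set.Icc _ _ from ⟨by linarith, by linarith⟩)
  refine ⟨x, ?_, hx⟩
  simp only [planeSet3, Set.mem_ofPred_eq]
  simp only at hx0
  linarith

theorem card_le_crossCount3 {P : Finset (ℝ × ℝ × ℝ)} {n k : ℕ}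
    {parts : Fin ((n + k - 1) / k) → Finset (ℝ × ℝ × ℝ)}
    {tri : Fin ((n + k - 1) / k) → Fin 4 → ℝ × ℝ × ℝ} (hP : IsKPartition3 P n k parts tri)
    {a b c : ℝ} (I : Finset (Fin ((n + k - 1) / k)))
    (hI : ∀ i ∈ I, (∃ p ∈ parts i, p ∈ belowSet3 a b c) ∧ ∃ q ∈ parts i, q ∉ belowSet3 a b c) :
    I.card ≤ crossCount3 tri a b c := by
  refine Finset.card_le_card fun i hi => ?_
  obtain ⟨⟨p, hp, hpb⟩, q, hq, hqb⟩ := hI i hi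
  exact Finset.mem_filter.2 ⟨Finset.mem_univ _,
    planeSet3_inter_simplex3_nonempty (hP.inSimplex i hp) (hP.inSimplex i hq) hpb hqb⟩

theorem IsKPartition3.card_le {P : Finset (ℝ × ℝ × ℝ)} {n k : ℕ}
    {parts : Fin ((n + k - 1) / k) → Finset (ℝ × ℝ × ℝ)}
    {tri : Fin ((n + k - 1) / k) → Fin 4 → ℝ × ℝ × ℝ} (hP : IsKPartition3 P n k parts tri)
    (hn : P.card = n) (hk : 0 < k) (i : Fin ((n + k - 1) / k)) : (parts i).card ≤ k := by
  by_cases hi : (i : ℕ) < n / k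
  · exact (hP.size i hi).le
  have hle : n / k ≤ (n + k - 1) / k := Nat.div_le_div_right (by omega)
  have hsum : ∑ j, (parts j).card = n := by
    refine Eq.trans ?_ ((congrArg Finset.card hP.cover).trans hn)
    exact (Finset.card_biUnion fun a _ b _ hab => hP.disjoint a b hab).symm
  have hsub : (insert i (Finset.univ.filter fun j : Fin ((n + k - 1) / k) => (j : ℕ) < n / k)) ⊆
      Finset.univ := Finset.subset_univ _
  have h1 := Finset.sum_le_sum_of_subset (f := fun j => (parts j).card) hsub
  rw [Finset.sum_insert (by simp; omega), hsum, Finset.sum_congr rfl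
    (g := fun _ => k) (fun j hj => hP.size j (Finset.mem_filter.1 hj).2)] at h1
  have hc : (Finset.univ.filter fun j : Fin ((n + k - 1) / k) => (j : ℕ) < n / k).card = n / k := by
    rw [Fin.card_filter_val_lt, min_eq_right hle]
  rw [Finset.sum_const, hc, smul_eq_mul] at h1
  have := Nat.div_add_mod n k
  have := Nat.mod_lt n hk
  rw [mul_comm] at h1
  omega

/-- Level, position within the level, and multiplicity index of a point. Position `j` at level
`l` represents the `B`-adic block of the integers `u` with `u / B ^ l = j`. -/
abbrev TreeIndex := ℕ × ℕ × ℕ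

/-- The blocks of levels `< h` inside `[0, B ^ h)`, each repeated `s` times, together with `F`
blocks of level `h` disjoint from `[0, B ^ h)`. -/
def treeIndices (B h s F : ℕ) : Finset TreeIndex :=
  ((Finset.range h).biUnion fun l =>
      ({l} : Finset ℕ) ×ˢ Finset.range (B ^ (h - l)) ×ˢ Finset.range s) ∪
    ({h} : Finset ℕ) ×ˢ Finset.Icc 1 F ×ˢ ({0} : Finset ℕ)

theorem mem_treeIndices {B h s F : ℕ} {x : TreeIndex} :
    x ∈ treeIndices B h s F ↔ (x.1 < h ∧ x.2.1 < B ^ (h - x.1) ∧ x.2.2 < s) ∨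
      (x.1 = h ∧ (1 ≤ x.2.1 ∧ x.2.1 ≤ F) ∧ x.2.2 = 0) := by
  obtain ⟨l, j, t⟩ := x
  simp only [treeIndices, Finset.mem_union, Finset.mem_biUnion, Finset.mem_product,
    Finset.mem_singleton, Finset.mem_range, Finset.mem_Icc]
  constructor
  · rintro (⟨l', hl', rfl, h1, h2⟩ | h1)
    · exact Or.inl ⟨hl', h1, h2⟩
    · exact Or.inr h1
  · rintro (⟨hl, h1, h2⟩ | h1)
    · exact Or.inl ⟨l, hl, rfl, h1, h2⟩
    · exact Or.inr h1

theorem card_treeIndices (B h s F : ℕ) :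
    (treeIndices B h s F).card = ∑ l ∈ Finset.range h, B ^ (h - l) * s + F := by
  rw [treeIndices, Finset.card_union_of_disjoint, Finset.card_biUnion]
  · simp
  · intro a _ b _ hab
    rw [Function.onFun, Finset.disjoint_left]
    rintro ⟨l, j, t⟩ h1 h2
    simp at h1 h2
    omega
  · rw [Finset.disjoint_left]
    rintro ⟨l, j, t⟩ h1 h2
    simp at h1 h2
    omega

theorem sum_pow_sub_le {B : ℕ} (hB : 2 ≤ B) (h : ℕ) :
    ∑ l ∈ Finset.range h, B ^ (h - l) ≤ B ^ (h + 1) := by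
  induction h with
  | zero => simp
  | succ h ih =>
    rw [Finset.sum_range_succ']
    simp only [Nat.add_sub_add_right, Nat.sub_zero]
    calc _ ≤ B ^ (h + 1) + B ^ (h + 1) := Nat.add_le_add_right ih _
      _ = 2 * B ^ (h + 1) := by ring
      _ ≤ B * B ^ (h + 1) := Nat.mul_le_mul_right _ hB
      _ = B ^ (h + 1 + 1) := by ring

/-- The integer `u` lies in the block of `x`. -/
def Stabs (B u : ℕ) (x : TreeIndex) : Prop := u / B ^ x.1 = x.2.1

/-- The number of `u < B ^ h` in the block of `x`. -/
def blockCard (B h : ℕ) (x : TreeIndex) : ℕ :=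
  ((Finset.range (B ^ h)).filter fun u => Stabs B u x).card

theorem stabs_iff {B u : ℕ} (hB : 0 < B) {x : TreeIndex} :
    Stabs B u x ↔ x.2.1 * B ^ x.1 ≤ u ∧ u < (x.2.1 + 1) * B ^ x.1 := by
  rw [Stabs, Nat.div_eq_iff (pow_pos hB _)]
  have := pow_pos hB x.1
  rw [add_mul]
  omega

theorem blockCard_le {B h : ℕ} (hB : 0 < B) (x : TreeIndex) : blockCard B h x ≤ B ^ x.1 := by
  calc blockCard B h x ≤ (Finset.Ico (x.2.1 * B ^ x.1) ((x.2.1 + 1) * B ^ x.1)).card := by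
        refine Finset.card_le_card fun u hu => ?_
        exact Finset.mem_Ico.2 ((stabs_iff hB).1 (Finset.mem_filter.1 hu).2)
    _ = B ^ x.1 := by rw [Nat.card_Ico, add_mul]; omega

theorem le_blockCard {B h : ℕ} (hB : 0 < B) {x : TreeIndex} (hx : x.1 ≤ h)
    (hj : x.2.1 < B ^ (h - x.1)) : B ^ x.1 ≤ blockCard B h x := by
  calc B ^ x.1 = (Finset.Ico (x.2.1 * B ^ x.1) ((x.2.1 + 1) * B ^ x.1)).card := by
        rw [Nat.card_Ico, add_mul]; omega
    _ ≤ blockCard B h x := by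
        refine Finset.card_le_card fun u hu => ?_
        rw [Finset.mem_Ico] at hu
        refine Finset.mem_filter.2 ⟨Finset.mem_range.2 ?_, (stabs_iff hB).2 hu⟩
        calc u < (x.2.1 + 1) * B ^ x.1 := hu.2
          _ ≤ B ^ (h - x.1) * B ^ x.1 := Nat.mul_le_mul_right _ hj
          _ = B ^ h := by rw [← pow_add, Nat.sub_add_cancel hx]

theorem not_stabs_of_level_ge {B h s F u : ℕ} {x : TreeIndex} (hx : x ∈ treeIndices B h s F)
    (hl : h ≤ x.1) (hu : u < B ^ h) : ¬ Stabs B u x := by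
  rcases mem_treeIndices.1 hx with hx | ⟨h1, h2, -⟩
  · omega
  · rw [Stabs, h1, Nat.div_eq_of_lt hu]
    omega

theorem card_filter_stabs {B h s F u : ℕ} (hB : 0 < B) (hu : u < B ^ h) :
    ((treeIndices B h s F).filter fun x => Stabs B u x).card = h * s := by
  have : (treeIndices B h s F).filter (fun x => Stabs B u x) =
      (Finset.range h ×ˢ Finset.range s).image fun y => (y.1, u / B ^ y.1, y.2) := by
    ext ⟨l, j, t⟩
    simp only [Finset.mem_filter, Finset.mem_image, Finset.mem_product, Finset.mem_range,
      Prod.exists, Prod.mk.injEq]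
    constructor
    · rintro ⟨hx, hs⟩
      have hl : l < h := by
        by_contra hl
        exact not_stabs_of_level_ge hx (not_lt.1 hl) hu hs
      rcases mem_treeIndices.1 hx with hx | hx
      · exact ⟨l, t, ⟨hl, hx.2.2⟩, rfl, hs, rfl⟩
      · exact absurd hx.1 hl.ne
    · rintro ⟨l', t', ⟨hl, ht⟩, rfl, rfl, rfl⟩
      refine ⟨mem_treeIndices.2 (Or.inl ⟨hl, ?_, ht⟩), rfl⟩
      rw [Nat.div_lt_iff_lt_mul (pow_pos hB _), ← pow_add, Nat.sub_add_cancel hl.le]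
      exact hu
  rw [this, Finset.card_image_of_injective, Finset.card_product, Finset.card_range,
    Finset.card_range]
  rintro ⟨a, b⟩ ⟨c, d⟩ hab
  simp only [Prod.mk.injEq] at hab
  simp [hab.1, hab.2.2]

theorem sum_blockCard_eq (B h : ℕ) (g : Finset TreeIndex) :
    ∑ x ∈ g, blockCard B h x =
      ∑ u ∈ Finset.range (B ^ h), (g.filter fun x => Stabs B u x).card :=
  Finset.sum_card_bipartiteAbove_eq_sum_card_bipartiteBelow (fun x u => Stabs B u x)

/-- A group of at most `2 s B` points wastes at most a constant factor of the incidences: the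
points of top level cover each `u` at most `s` times, and the other ones are shorter by a
factor of `B`. -/
theorem sum_blockCard_le {B h s F : ℕ} (hB : 0 < B) {g : Finset TreeIndex}
    (hg : g ⊆ treeIndices B h s F) (hcard : g.card ≤ 2 * s * B) :
    ∑ x ∈ g, blockCard B h x ≤
      3 * s * ((Finset.range (B ^ h)).filter fun u => ∃ x ∈ g, Stabs B u x).card := by
  set H := (Finset.range (B ^ h)).filter fun u => ∃ x ∈ g, Stabs B u x with hH
  have hbig : ∀ x ∈ g, h ≤ x.1 → blockCard B h x = 0 := by
    intro x hx hl
    rw [blockCard, Finset.card_eq_zero, Finset.filter_eq_empty_iff]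
    exact fun u hu => not_stabs_of_level_ge (hg hx) hl (Finset.mem_range.1 hu)
  rcases (g.filter fun x => x.1 < h).eq_empty_or_nonempty with he | hne
  · rw [Finset.sum_eq_zero]
    · exact Nat.zero_le _
    · intro x hx
      rw [Finset.filter_eq_empty_iff] at he
      exact hbig x hx (not_lt.1 (he hx))
  obtain ⟨y, hy, hmax⟩ := Finset.exists_max_image _ (fun x : TreeIndex => x.1) hne
  rw [Finset.mem_filter] at hy
  have hyH : B ^ y.1 ≤ H.card := by
    rcases mem_treeIndices.1 (hg hy.1) with h' | h'
    · refine (le_blockCard hB hy.2.le h'.2.1).trans (Finset.card_le_card fun u hu => ?_)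
      rw [Finset.mem_filter] at hu
      exact Finset.mem_filter.2 ⟨hu.1, y, hy.1, hu.2⟩
    · exact absurd h'.1 hy.2.ne
  have hsplit : ∑ x ∈ g, blockCard B h x ≤ ∑ x ∈ g.filter (fun x => x.1 = y.1), blockCard B h x +
      ∑ x ∈ g.filter (fun x => x.1 < y.1), blockCard B h x := by
    rw [Finset.sum_filter, Finset.sum_filter, ← Finset.sum_add_distrib]
    refine Finset.sum_le_sum fun x hx => ?_
    rcases lt_trichotomy x.1 y.1 with h1 | h1 | h1
    · simp [h1]
    · simp [h1]
    · have : h ≤ x.1 := by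
        by_contra hlt
        have := hmax x (Finset.mem_filter.2 ⟨hx, not_le.1 hlt⟩)
        omega
      simp [hbig x hx this]
  have htop : ∑ x ∈ g.filter (fun x => x.1 = y.1), blockCard B h x ≤ s * H.card := by
    rw [sum_blockCard_eq, mul_comm, ← smul_eq_mul, ← Finset.sum_const, hH, Finset.sum_filter]
    refine Finset.sum_le_sum fun u hu => ?_
    split_ifs with hex
    · rw [← Finset.card_range s]
      refine Finset.card_le_card_of_injOn (fun x => x.2.2) ?_ ?_
      · intro x hx
        simp only [Finset.coe_filter, Finset.mem_filter, Set.mem_ofPred_eq] at hx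
        rcases mem_treeIndices.1 (hg hx.1.1) with h' | h'
        · simpa using h'.2.2
        · have := hy.2
          omega
      · rintro ⟨l, j, t⟩ hx ⟨l', j', t'⟩ hx' ht
        rw [Finset.mem_coe, Finset.mem_filter, Finset.mem_filter] at hx hx'
        obtain ⟨⟨-, h1⟩, h2⟩ := hx
        obtain ⟨⟨-, h1'⟩, h2'⟩ := hx'
        simp only [Stabs] at h1 h1' h2 h2' ht
        subst h1 h1' h2 h2' ht
        rfl
    · rw [Nat.le_zero, Finset.card_eq_zero, Finset.filter_eq_empty_iff]
      exact fun x hx hst => hex ⟨x, (Finset.mem_filter.1 hx).1, hst⟩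
  have hlow : ∑ x ∈ g.filter (fun x => x.1 < y.1), blockCard B h x ≤ 2 * s * H.card := by
    refine Nat.le_of_mul_le_mul_left ?_ hB
    calc B * ∑ x ∈ g.filter (fun x => x.1 < y.1), blockCard B h x
        = ∑ x ∈ g.filter (fun x => x.1 < y.1), B * blockCard B h x := Finset.mul_sum _ _ _
      _ ≤ ∑ x ∈ g.filter (fun x => x.1 < y.1), B ^ y.1 := by
          refine Finset.sum_le_sum fun x hx => ?_
          calc B * blockCard B h x ≤ B * B ^ x.1 := Nat.mul_le_mul_left _ (blockCard_le hB x)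
            _ = B ^ (x.1 + 1) := by ring
            _ ≤ B ^ y.1 := Nat.pow_le_pow_right hB (Finset.mem_filter.1 hx).2
      _ = (g.filter (fun x => x.1 < y.1)).card * B ^ y.1 := by simp
      _ ≤ (2 * s * B) * H.card :=
          Nat.mul_le_mul ((Finset.card_filter_le _ _).trans hcard) hyH
      _ = B * (2 * s * H.card) := by ring
  calc _ ≤ s * H.card + 2 * s * H.card := hsplit.trans (Nat.add_le_add htop hlow)
    _ = 3 * s * H.card := by ring

/-- Some `u` stabs blocks from at least `h / 3` of the groups. -/
theorem exists_stabs_many {ι : Type*} [Fintype ι] {B h s F : ℕ} (hB : 0 < B) (hs : 0 < s)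
    (G : ι → Finset TreeIndex) (hsub : ∀ i, G i ⊆ treeIndices B h s F)
    (hdisj : ∀ i j, i ≠ j → Disjoint (G i) (G j))
    (hcover : Finset.univ.biUnion G = treeIndices B h s F)
    (hcard : ∀ i, (G i).card ≤ 2 * s * B) :
    ∃ u < B ^ h, h ≤ 3 * (Finset.univ.filter fun i => ∃ x ∈ G i, Stabs B u x).card := by
  by_contra! hcon
  have h1 : ∑ x ∈ treeIndices B h s F, blockCard B h x = B ^ h * (h * s) := by
    rw [sum_blockCard_eq, Finset.sum_congr rfl fun u hu =>
      card_filter_stabs hB (Finset.mem_range.1 hu)]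
    simp
  have h2 : ∑ x ∈ treeIndices B h s F, blockCard B h x = ∑ i, ∑ x ∈ G i, blockCard B h x := by
    rw [← hcover, Finset.sum_biUnion fun a _ b _ hab => hdisj a b hab]
  have h3 : ∑ i, ∑ x ∈ G i, blockCard B h x ≤ 3 * s * ∑ u ∈ Finset.range (B ^ h),
      (Finset.univ.filter fun i => ∃ x ∈ G i, Stabs B u x).card := by
    calc _ ≤ ∑ i, 3 * s *
          ((Finset.range (B ^ h)).filter fun u => ∃ x ∈ G i, Stabs B u x).card :=
          Finset.sum_le_sum fun i _ => sum_blockCard_le hB (hsub i) (hcard i)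
      _ = _ := by
          rw [← Finset.mul_sum]
          congr 1
          exact Finset.sum_card_bipartiteAbove_eq_sum_card_bipartiteBelow
            (fun i u => ∃ x ∈ G i, Stabs B u x)
  have h4 : ∑ u ∈ Finset.range (B ^ h),
      3 * (Finset.univ.filter fun i => ∃ x ∈ G i, Stabs B u x).card <
      ∑ u ∈ Finset.range (B ^ h), h :=
    Finset.sum_lt_sum_of_nonempty ⟨0, Finset.mem_range.2 (pow_pos hB h)⟩
      fun u hu => hcon u (Finset.mem_range.1 hu)
  rw [← Finset.mul_sum, Finset.sum_const, Finset.card_range, smul_eq_mul] at h4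
  rw [← h2, h1] at h3
  have := Nat.mul_lt_mul_of_pos_left h4 hs
  nlinarith

theorem sq_sub_mid_lt_of_mem {u j w : ℕ} (h₁ : j * w ≤ u) (h₂ : u < (j + 1) * w) :
    ((u : ℝ) - (j * w + (w - 1) / 2)) ^ 2 < (w / 2 : ℝ) ^ 2 := by
  have h1 : (j : ℝ) * w ≤ u := by exact_mod_cast h₁
  have h2 : (u : ℝ) + 1 ≤ (j + 1) * w := by exact_mod_cast h₂
  nlinarith [mul_pos (show (0 : ℝ) < w - 1 / 2 - (u - j * w) by linarith)
    (show (0 : ℝ) < u - j * w + 1 / 2 by linarith)]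

theorem lt_sq_sub_mid_of_not_mem {u j w : ℕ} (h : ¬ (j * w ≤ u ∧ u < (j + 1) * w)) :
    (w / 2 : ℝ) ^ 2 < ((u : ℝ) - (j * w + (w - 1) / 2)) ^ 2 := by
  have hw : (0 : ℝ) ≤ w := Nat.cast_nonneg w
  rcases lt_or_ge u (j * w) with h1 | h1
  · have h1 : (u : ℝ) + 1 ≤ j * w := by exact_mod_cast h1
    nlinarith [mul_pos (show (0 : ℝ) < w - 1 / 2 - (u - j * w) by linarith)
      (show (0 : ℝ) < -(u - j * w + 1 / 2) by linarith)]
  · have h2 : (j + 1) * w ≤ u := not_lt.1 fun h2 => h ⟨h1, h2⟩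
    have h2 : ((j : ℝ) + 1) * w ≤ u := by exact_mod_cast h2
    nlinarith [mul_pos (show (0 : ℝ) < -(w - 1 / 2 - (u - j * w)) by linarith)
      (show (0 : ℝ) < u - j * w + 1 / 2 by linarith)]

theorem exists_crossCount3_ge_of_pow_le {n k B h : ℕ} (hB : 2 ≤ B) (hBk : B ≤ k) (hhB : h < B)
    (hpow : k * B ^ h ≤ n) :
    ∃ P : Finset (ℝ × ℝ × ℝ), P.card = n ∧ GenPos3 P ∧
      ∀ (parts : Fin ((n + k - 1) / k) → Finset (ℝ × ℝ × ℝ))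
        (tri : Fin ((n + k - 1) / k) → Fin 4 → ℝ × ℝ × ℝ),
        IsKPartition3 P n k parts tri →
        ∃ a b c' : ℝ, IsShallow3 P k a b c' ∧ h ≤ 3 * (crossCount3 tri a b c' + 1) := by
  have hB0 : 0 < B := by omega
  have hk0 : 0 < k := by omega
  set s := k / B with hs
  have hs0 : 0 < s := Nat.div_pos hBk hB0
  have hsB : s * B ≤ k := Nat.div_mul_le_self k B
  have hks : k ≤ 2 * s * B := by
    have := Nat.lt_div_mul_add (a := k) hB0
    nlinarith
  have hhs : h * s < k := by nlinarith
  have hsum : ∑ l ∈ Finset.range h, B ^ (h - l) * s ≤ n := by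
    rw [← Finset.sum_mul]
    calc _ ≤ B ^ (h + 1) * s := Nat.mul_le_mul_right _ (sum_pow_sub_le hB h)
      _ = (s * B) * B ^ h := by ring
      _ ≤ k * B ^ h := Nat.mul_le_mul_right _ hsB
      _ ≤ n := hpow
  set F := n - ∑ l ∈ Finset.range h, B ^ (h - l) * s with hF
  set S := treeIndices B h s F with hS
  have hScard : S.card = n := by rw [hS, card_treeIndices]; omega
  obtain ⟨p, hinj, hgen, hp⟩ := exists_genPos3_interval S
    (fun x => (Encodable.encode x : ℝ)) (Nat.cast_injective.comp Encodable.encode_injective)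
    (fun x => x.2.1 * (B ^ x.1 : ℕ) + ((B ^ x.1 : ℕ) - 1) / 2)
    (fun x => ((B ^ x.1 : ℕ) / 2 : ℝ) ^ 2) (Finset.range (B ^ h)) (by
      intro x _ u _
      by_cases hx : x.2.1 * B ^ x.1 ≤ u ∧ u < (x.2.1 + 1) * B ^ x.1
      · exact (sq_sub_mid_lt_of_mem hx.1 hx.2).ne
      · exact (lt_sq_sub_mid_of_not_mem hx).ne')
  have hbelow : ∀ x ∈ S, ∀ u < B ^ h, (p x ∈ belowSet3 u (u ^ 2) 0 ↔ Stabs B u x) := by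
    intro x hx u hu
    rw [(hp x hx u (Finset.mem_range.2 hu)).2, stabs_iff hB0]
    refine ⟨fun hlt => ?_, fun hx => sq_sub_mid_lt_of_mem hx.1 hx.2⟩
    by_contra hcon
    exact (lt_sq_sub_mid_of_not_mem hcon).not_gt hlt
  refine ⟨S.image p, by rw [Finset.card_image_of_injOn hinj, hScard], hgen, ?_⟩
  intro parts tri hP
  have hPn : (S.image p).card = n := by rw [Finset.card_image_of_injOn hinj, hScard]
  have hmem : ∀ i, ∀ q ∈ parts i, ∃ x ∈ S, p x = q := fun i q hq => by
    have : q ∈ Finset.univ.biUnion parts := Finset.mem_biUnion.2 ⟨i, Finset.mem_univ _, hq⟩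
    rw [hP.cover] at this
    exact Finset.mem_image.1 this
  set G : Fin ((n + k - 1) / k) → Finset TreeIndex := fun i => S.filter fun x => p x ∈ parts i
    with hG
  obtain ⟨u, hu, hmany⟩ := exists_stabs_many (F := F) hB0 hs0 G
    (fun i => Finset.filter_subset _ _)
    (fun i j hij => by
      rw [Finset.disjoint_left]
      intro x hx hx'
      exact Finset.disjoint_left.1 (hP.disjoint i j hij) (Finset.mem_filter.1 hx).2
        (Finset.mem_filter.1 hx').2)
    (by
      ext x
      simp only [hG, Finset.mem_biUnion, Finset.mem_univ, true_and, Finset.mem_filter]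
      refine ⟨fun ⟨i, hi⟩ => hi.1, fun hx => ?_⟩
      have : p x ∈ Finset.univ.biUnion parts := by
        rw [hP.cover]
        exact Finset.mem_image_of_mem p hx
      obtain ⟨i, -, hi⟩ := Finset.mem_biUnion.1 this
      exact ⟨i, hx, hi⟩)
    (fun i => by
      refine le_trans (le_trans ?_ (hP.card_le hPn hk0 i)) hks
      refine Finset.card_le_card_of_injOn p (fun x hx => (Finset.mem_filter.1 hx).2) ?_
      exact hinj.mono fun x hx => (Finset.mem_filter.1 hx).1)
  have hcardbelow : ((S.image p).filter fun q => q ∈ belowSet3 u (u ^ 2) 0).card = h * s := by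
    rw [← card_filter_stabs (s := s) (F := F) hB0 hu, Finset.filter_image,
      Finset.card_image_of_injOn (hinj.mono fun x hx => (Finset.mem_filter.1 hx).1)]
    exact congrArg Finset.card (Finset.filter_congr fun x hx => hbelow x hx u hu)
  refine ⟨u, u ^ 2, 0, ⟨?_, by rw [hcardbelow]; exact hhs.le⟩, ?_⟩
  · intro q hq
    obtain ⟨x, hx, rfl⟩ := Finset.mem_image.1 hq
    exact (hp x hx u (Finset.mem_range.2 hu)).1
  set I := Finset.univ.filter fun i => ∃ x ∈ G i, Stabs B u x with hI
  have hcross : (I.filter fun i : Fin ((n + k - 1) / k) => (i : ℕ) < n / k).card ≤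
      crossCount3 tri u (u ^ 2) 0 := by
    refine card_le_crossCount3 hP _ fun i hi => ?_
    rw [Finset.mem_filter, hI, Finset.mem_filter] at hi
    obtain ⟨⟨-, x, hx, hst⟩, hik⟩ := hi
    rw [hG, Finset.mem_filter] at hx
    refine ⟨⟨p x, hx.2, (hbelow x hx.1 u hu).2 hst⟩, ?_⟩
    by_contra! hall
    have hle : (parts i).card ≤
        ((S.image p).filter fun q => q ∈ belowSet3 u (u ^ 2) 0).card := by
      refine Finset.card_le_card fun q hq => Finset.mem_filter.2 ⟨?_, hall q hq⟩
      obtain ⟨y, hy, rfl⟩ := hmem i q hq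
      exact Finset.mem_image_of_mem p hy
    rw [hP.size i hik, hcardbelow] at hle
    omega
  have hlast : (I.filter fun i : Fin ((n + k - 1) / k) => ¬ (i : ℕ) < n / k).card ≤ 1 := by
    rw [Finset.card_le_one]
    intro i hi j hj
    have hN : (n + k - 1) / k ≤ n / k + 1 := by
      rw [← Nat.add_div_right n hk0]
      exact Nat.div_le_div_right (by omega)
    have h1 := (Finset.mem_filter.1 hi).2
    have h2 := (Finset.mem_filter.1 hj).2
    have := i.isLt
    have := j.isLt
    exact Fin.ext (by omega)
  have := Finset.card_filter_add_card_filter_not (s := I)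
    fun i : Fin ((n + k - 1) / k) => (i : ℕ) < n / k
  omega

theorem exists_one_le_crossCount3 {n k : ℕ} (hk : 2 ≤ k) (hkn : k ≤ n) :
    ∃ P : Finset (ℝ × ℝ × ℝ), P.card = n ∧ GenPos3 P ∧
      ∀ (parts : Fin ((n + k - 1) / k) → Finset (ℝ × ℝ × ℝ))
        (tri : Fin ((n + k - 1) / k) → Fin 4 → ℝ × ℝ × ℝ),
        IsKPartition3 P n k parts tri →
        ∃ a b c' : ℝ, IsShallow3 P k a b c' ∧ 1 ≤ crossCount3 tri a b c' := by
  have hfar : ∀ u i : ℕ, u ≠ i → (1 : ℝ) ≤ ((u : ℝ) - i) ^ 2 := by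
    intro u i hui
    have : (1 : ℤ) ≤ ((u : ℤ) - i) ^ 2 := by
      have : 0 < ((u : ℤ) - i) ^ 2 := by
        have : (u : ℤ) - i ≠ 0 := by omega
        positivity
      omega
    exact_mod_cast this
  obtain ⟨p, hinj, hgen, hp⟩ := exists_genPos3_interval (Finset.range n)
    (fun i : ℕ => (i : ℝ)) Nat.cast_injective (fun i => (i : ℝ)) (fun _ => 1 / 2)
    (Finset.range n) (by
      intro i _ u _
      rcases eq_or_ne u i with rfl | hui
      · norm_num
      · linarith [hfar u i hui])
  have hPn : ((Finset.range n).image p).card = n := by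
    rw [Finset.card_image_of_injOn hinj, Finset.card_range]
  have hbelow : ∀ i < n, ∀ u < n, (p i ∈ belowSet3 u (u ^ 2) 0 ↔ u = i) := by
    intro i hi u hu
    rw [(hp i (Finset.mem_range.2 hi) u (Finset.mem_range.2 hu)).2]
    refine ⟨fun hlt => ?_, by rintro rfl; norm_num⟩
    by_contra hui
    linarith [hfar u i hui]
  refine ⟨_, hPn, hgen, fun parts tri hP => ?_⟩
  have hpos : 0 < n / k := Nat.div_pos hkn (by omega)
  let i₀ : Fin ((n + k - 1) / k) :=
    ⟨0, hpos.trans_le (Nat.div_le_div_right (by omega))⟩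
  have hsub : ∀ q ∈ parts i₀, ∃ i < n, p i = q := fun q hq => by
    have : q ∈ Finset.univ.biUnion parts := Finset.mem_biUnion.2 ⟨i₀, Finset.mem_univ _, hq⟩
    rw [hP.cover] at this
    simpa using this
  obtain ⟨q, hq, q', hq', hne⟩ := Finset.one_lt_card.1
    (show 1 < (parts i₀).card by rw [hP.size i₀ hpos]; omega)
  obtain ⟨u, hu, rfl⟩ := hsub q hq
  obtain ⟨v, hv, rfl⟩ := hsub q' hq'
  refine ⟨u, u ^ 2, 0, ⟨?_, ?_⟩, ?_⟩
  · intro x hx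
    obtain ⟨i, hi, rfl⟩ := Finset.mem_image.1 hx
    exact (hp i hi u (Finset.mem_range.2 hu)).1
  · refine le_trans (Finset.card_le_one.2 ?_) (show 1 ≤ k by omega)
    have huniq : ∀ x ∈ ((Finset.range n).image p).filter
        (fun x => x ∈ belowSet3 u (u ^ 2) 0), x = p u := by
      intro x hx
      obtain ⟨hx, hxb⟩ := Finset.mem_filter.1 hx
      obtain ⟨i, hi, rfl⟩ := Finset.mem_image.1 hx
      rw [(hbelow i (Finset.mem_range.1 hi) u hu).1 hxb]
    intro x hx y hy
    rw [huniq x hx, huniq y hy]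
  · refine (Finset.card_singleton i₀).ge.trans (card_le_crossCount3 hP _ fun i hi => ?_)
    rw [Finset.mem_singleton.1 hi]
    refine ⟨⟨p u, hq, (hbelow u hu u hu).2 rfl⟩, p v, hq', fun h => hne ?_⟩
    rw [(hbelow v hv u hu).1 h]

/-- With `L = log₂ (n / k)`, the branching number `⌊L⌋` and depth `⌊L / log₂ L⌋` are admissible. -/
theorem exists_crossCount3_ge_of_large {n k : ℕ} (hk : 0 < k)
    (hlog : Real.logb 2 (n : ℝ) ≤ (k : ℝ)) (hn : 4 * k ≤ n)
    (hX : 8 ≤ Real.logb 2 ((n : ℝ) / k) / Real.logb 2 (Real.logb 2 ((n : ℝ) / k))) :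
    ∃ P : Finset (ℝ × ℝ × ℝ), P.card = n ∧ GenPos3 P ∧
      ∀ (parts : Fin ((n + k - 1) / k) → Finset (ℝ × ℝ × ℝ))
        (tri : Fin ((n + k - 1) / k) → Fin 4 → ℝ × ℝ × ℝ),
        IsKPartition3 P n k parts tri →
        ∃ a b c' : ℝ, IsShallow3 P k a b c' ∧
          1 / 8 * (Real.logb 2 ((n : ℝ) / k) / Real.logb 2 (Real.logb 2 ((n : ℝ) / k))) ≤
            (crossCount3 tri a b c' : ℝ) := by
  have hkR : (1 : ℝ) ≤ k := by exact_mod_cast hk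
  have hnR : (4 : ℝ) * k ≤ n := by exact_mod_cast hn
  have hm : (4 : ℝ) ≤ (n : ℝ) / k := by rwa [le_div_iff₀ (by linarith)]
  set m : ℝ := (n : ℝ) / k with hmdef
  set L : ℝ := Real.logb 2 m with hL
  have hL2 : 2 ≤ L := by
    rw [hL, Real.le_logb_iff_rpow_le (by norm_num) (by linarith)]
    norm_num
    exact hm
  have hLL1 : 1 ≤ Real.logb 2 L := by
    rw [Real.le_logb_iff_rpow_le (by norm_num) (by linarith)]
    norm_num
    exact hL2
  have hL8 : 8 ≤ L := hX.trans (div_le_self (by linarith) hLL1)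
  have hLL2 : 2 ≤ Real.logb 2 L := by
    rw [Real.le_logb_iff_rpow_le (by norm_num) (by linarith)]
    norm_num
    linarith
  set X : ℝ := L / Real.logb 2 L with hXdef
  have hXL : X ≤ L / 2 := div_le_div_of_nonneg_left (by linarith) (by norm_num) hLL2
  have hfB : (⌊L⌋₊ : ℝ) ≤ L := Nat.floor_le (by linarith)
  have hfB' : L < ⌊L⌋₊ + 1 := Nat.lt_floor_add_one L
  have hfh : (⌊X⌋₊ : ℝ) ≤ X := Nat.floor_le (by linarith)
  have hfh' : X < ⌊X⌋₊ + 1 := Nat.lt_floor_add_one X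
  have hLk : L ≤ k := by
    refine le_trans ?_ hlog
    exact Real.logb_le_logb_of_le (by norm_num) (by linarith)
      (div_le_self (by linarith) hkR)
  have hpow : (k : ℝ) * (⌊L⌋₊ : ℝ) ^ ⌊X⌋₊ ≤ n := by
    have h1 : (⌊L⌋₊ : ℝ) ^ ⌊X⌋₊ ≤ m := by
      calc (⌊L⌋₊ : ℝ) ^ ⌊X⌋₊ ≤ L ^ ⌊X⌋₊ := pow_le_pow_left₀ (Nat.cast_nonneg _) hfB _
        _ = L ^ (⌊X⌋₊ : ℝ) := (Real.rpow_natCast _ _).symm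
        _ ≤ L ^ X := Real.rpow_le_rpow_of_exponent_le (by linarith) hfh
        _ = (2 ^ Real.logb 2 L) ^ X := by
          rw [Real.rpow_logb (by norm_num) (by norm_num) (by linarith)]
        _ = 2 ^ (Real.logb 2 L * X) := (Real.rpow_mul (by norm_num) _ _).symm
        _ = 2 ^ L := by rw [hXdef, mul_div_cancel₀ _ (by linarith)]
        _ = m := Real.rpow_logb (by norm_num) (by norm_num) (by linarith)
    calc (k : ℝ) * (⌊L⌋₊ : ℝ) ^ ⌊X⌋₊ ≤ k * m := by gcongr
      _ = n := by rw [hmdef, mul_div_cancel₀ _ (by linarith)]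
  obtain ⟨P, hPn, hgen, hP⟩ := exists_crossCount3_ge_of_pow_le (n := n) (k := k) (B := ⌊L⌋₊)
    (h := ⌊X⌋₊) (Nat.le_floor (by push_cast; linarith))
    (by exact_mod_cast hfB.trans hLk)
    (by
      have : (⌊X⌋₊ : ℝ) < ⌊L⌋₊ := by linarith
      exact_mod_cast this)
    (by exact_mod_cast hpow)
  refine ⟨P, hPn, hgen, fun parts tri hpart => ?_⟩
  obtain ⟨a, b, c', hsh, hc⟩ := hP parts tri hpart
  refine ⟨a, b, c', hsh, ?_⟩
  have hc : (⌊X⌋₊ : ℝ) ≤ 3 * (crossCount3 tri a b c' + 1) := by exact_mod_cast hc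
  linarith

/-- lower bound for shallow partitions in `ℝ³`.
There is a constant `c > 0` such that for every `n` and every `k` with
`log₂ n ≤ k ≤ n/4`, there exists an `n`-point set `P ⊆ ℝ³` in general
position such that every `k`-partition of `P` has crossing number at least
`c · log₂(n/k) / log₂ log₂ (n/k)` with respect to `k`-shallow planes. -/
theorem statement11 :
    ∃ c : ℝ, 0 < c ∧
      ∀ n k : ℕ, Real.logb 2 (n : ℝ) ≤ (k : ℝ) → 4 * k ≤ n →
        ∃ P : Finset (ℝ × ℝ × ℝ), P.card = n ∧ GenPos3 P ∧
          ∀ (parts : Fin ((n + k - 1) / k) → Finset (ℝ × ℝ × ℝ))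
            (tri : Fin ((n + k - 1) / k) → Fin 4 → ℝ × ℝ × ℝ),
            IsKPartition3 P n k parts tri →
            ∃ a b c' : ℝ, IsShallow3 P k a b c' ∧
              c * Real.logb 2 ((n : ℝ) / (k : ℝ)) /
                  Real.logb 2 (Real.logb 2 ((n : ℝ) / (k : ℝ))) ≤
                (crossCount3 tri a b c' : ℝ) := by
  refine ⟨1 / 8, by norm_num, fun n k hlog hn => ?_⟩
  rcases Nat.eq_zero_or_pos k with rfl | hk
  · refine ⟨(Finset.range n).image fun i : ℕ => ((i : ℝ), (0 : ℝ), (0 : ℝ)), ?_, ?_, ?_⟩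
    · rw [Finset.card_image_of_injective _ fun i j hij => by simpa using hij, Finset.card_range]
    · have hn1 : n ≤ 1 := by
        by_contra! h
        have := Real.logb_pos (b := 2) (by norm_num) (Nat.one_lt_cast.2 h)
        simp only [Nat.cast_zero] at hlog
        linarith
      intro p hp q hq _ _ _ _ hpq
      obtain ⟨i, hi, rfl⟩ := Finset.mem_image.1 hp
      obtain ⟨j, hj, rfl⟩ := Finset.mem_image.1 hq
      rw [Finset.mem_range] at hi hj
      exact absurd (congrArg (fun i : ℕ => ((i : ℝ), (0 : ℝ), (0 : ℝ))) (by omega)) hpq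
    · intro parts tri _
      refine ⟨0, 0, -1, ⟨fun p hp => ?_, ?_⟩, by simp⟩
      · obtain ⟨i, -, rfl⟩ := Finset.mem_image.1 hp
        simp [planeSet3]
      · rw [Nat.le_zero, Finset.card_eq_zero, Finset.filter_eq_empty_iff]
        intro p hp
        obtain ⟨i, -, rfl⟩ := Finset.mem_image.1 hp
        simp [belowSet3]
  rw [show ∀ x y : ℝ, 1 / 8 * x / y = 1 / 8 * (x / y) from fun x y => mul_div_assoc _ _ _]
  rcases le_or_gt 8 (Real.logb 2 ((n : ℝ) / k) / Real.logb 2 (Real.logb 2 ((n : ℝ) / k)))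
    with hX | hX
  · exact exists_crossCount3_ge_of_large hk hlog hn hX
  have hk2 : 2 ≤ k := by
    have h1 : (2 : ℝ) ≤ Real.logb 2 n := by
      have hnR : ((4 : ℕ) : ℝ) ≤ n := Nat.cast_le.2 (by omega)
      rw [Real.le_logb_iff_rpow_le (by norm_num)
        (by linarith [show ((4 : ℕ) : ℝ) = 4 by norm_num])]
      convert hnR using 1
      norm_num
    exact_mod_cast h1.trans hlog
  obtain ⟨P, hPn, hgen, hP⟩ := exists_one_le_crossCount3 hk2 (show k ≤ n by omega)
  refine ⟨P, hPn, hgen, fun parts tri hpart => ?_⟩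
  obtain ⟨a, b, c', hsh, hc⟩ := hP parts tri hpart
  refine ⟨a, b, c', hsh, ?_⟩
  have hc : (1 : ℝ) ≤ crossCount3 tri a b c' := by exact_mod_cast hc
  linarith

end
end
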